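/- Fix i ∈ {1,…,N}, T₀ > 0, C₁ > 0, ρ ∈ [R, 2R] and h ∈ (0, 1) with h < ρ. For σ ∈ {ρ, ρ − h}, let ψ_σ : ℝ² → [0,1] be a smooth radially symmetric function with ψ_σ = 1 on B_σ(0), ψ_σ = 0 outside B_{σ+h}(0), |∇ψ_σ| ≤ C₁/h and |∇²ψ_σ| ≤ C₁/h², and define μ_i(t, σ) = (1/a_i) ∫_{ℝ²} (1 − ψ_σ(x − X_i(t))) ω_i(t,x) dx. Then there exists a constant C > 0, depending only on N, a₁,…,a_N, δ, R, C₁ and T₀ (but not on ε, h, ρ or t), such that for every T ∈ (0, T₀] with dist(supp ω_k(s,·), supp ω_j(s,·)) ≥ δ/2 for all k ≠ j and all s ∈ [0,T], and every t ∈ [0,T], one has μ_i(t, ρ) ≤ μ_i(0, ρ) + C (ε²/h² + 1/h) ∫₀^t μ_i(s, ρ − h) ds. -/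

import Mathlib

open MeasureTheory
open scoped RealInnerProductSpace ENNReal Classical

/-- The two-dimensional Biot–Savart kernel `K(z) = (1/(2π)) z^⊥ / |z|²`, with `K(0) = 0`. -/
noncomputable def biotSavart (z : EuclideanSpace ℝ (Fin 2)) : EuclideanSpace ℝ (Fin 2) :=
  if z = 0 then 0 else
    (1 / (2 * Real.pi * ‖z‖ ^ 2)) • (EuclideanSpace.equiv (Fin 2) ℝ).symm ![-(z 1), z 0]

/-- A smooth radially symmetric cutoff at scales `σ, σ + h` with constant `C₁`. -/
def IsCutoff (C₁ σ h : ℝ) (ψ : EuclideanSpace ℝ (Fin 2) → ℝ) : Prop :=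
  ContDiff ℝ (⊤ : ℕ∞) ψ ∧ (∀ x y, ‖x‖ = ‖y‖ → ψ x = ψ y) ∧ (∀ x, ψ x ∈ Set.Icc (0:ℝ) 1) ∧
  (∀ x, ‖x‖ < σ → ψ x = 1) ∧ (∀ x, σ + h ≤ ‖x‖ → ψ x = 0) ∧
  (∀ x, ‖gradient ψ x‖ ≤ C₁ / h) ∧ (∀ x, ‖iteratedFDeriv ℝ 2 ψ x‖ ≤ C₁ / h ^ 2)
local notation "Plane" => EuclideanSpace ℝ (Fin 2)

/-- Rotation of the plane by a right angle. -/
noncomputable def rotPlane (z : Plane) : Plane := !₂[-(z 1), z 0]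

lemma rotPlane_sub (x y : Plane) : rotPlane (x - y) = rotPlane x - rotPlane y := by
  ext k; fin_cases k <;> simp [rotPlane]; ring

lemma rotPlane_smul (c : ℝ) (x : Plane) : rotPlane (c • x) = c • rotPlane x := by
  ext k; fin_cases k <;> simp [rotPlane]

lemma norm_rotPlane (x : Plane) : ‖rotPlane x‖ = ‖x‖ := by
  simp [EuclideanSpace.norm_eq, rotPlane, Fin.sum_univ_two, add_comm]

lemma inner_rotPlane_self (x : Plane) : ⟪rotPlane x, x⟫ = 0 := by
  simp [rotPlane, PiLp.inner_apply, Fin.sum_univ_two]; ring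

lemma biotSavart_eq (z : Plane) :
    biotSavart z = (2 * Real.pi)⁻¹ • rotPlane ((1 / ‖z‖) ^ 2 • z) := by
  rw [rotPlane_smul, smul_smul]
  by_cases h : z = 0
  · simp [biotSavart, h]
  · rw [biotSavart, if_neg h]
    congr 1
    field_simp

lemma norm_biotSavart (z : Plane) : ‖biotSavart z‖ = (2 * Real.pi)⁻¹ * ‖z‖⁻¹ := by
  rw [biotSavart_eq, norm_smul, norm_rotPlane, norm_smul]
  have := Real.pi_pos
  rw [Real.norm_of_nonneg (by positivity), Real.norm_of_nonneg (by positivity)]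
  rcases eq_or_ne ‖z‖ 0 with h | h
  · simp [h]
  · field_simp

lemma norm_biotSavart_le {z : Plane} {r : ℝ} (hr : 0 < r) (hz : r ≤ ‖z‖) :
    ‖biotSavart z‖ ≤ (2 * Real.pi * r)⁻¹ := by
  rw [norm_biotSavart, mul_inv (2 * Real.pi)]
  have := Real.pi_pos
  gcongr

lemma biotSavart_neg (z : Plane) : biotSavart (-z) = -biotSavart z := by
  rw [biotSavart_eq, biotSavart_eq, norm_neg, smul_neg, ← neg_one_smul ℝ, rotPlane_smul]
  simp

lemma inner_biotSavart_self (z : Plane) : ⟪biotSavart z, z⟫ = 0 := by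
  rw [biotSavart_eq, rotPlane_smul, inner_smul_left, inner_smul_left, inner_rotPlane_self]
  simp

lemma norm_biotSavart_sub_le {x y : Plane} {r : ℝ} (hr : 0 < r) (hx : r ≤ ‖x‖) (hy : r ≤ ‖y‖) :
    ‖biotSavart x - biotSavart y‖ ≤ (2 * Real.pi * r ^ 2)⁻¹ * ‖x - y‖ := by
  have hx0 : x ≠ 0 := norm_pos_iff.1 (hr.trans_le hx)
  have hy0 : y ≠ 0 := norm_pos_iff.1 (hr.trans_le hy)
  have := Real.pi_pos
  rw [biotSavart_eq, biotSavart_eq, ← smul_sub, ← rotPlane_sub, norm_smul, norm_rotPlane,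
    ← dist_eq_norm, dist_div_norm_sq_smul hx0 hy0, Real.norm_of_nonneg (by positivity),
    dist_eq_norm, mul_inv (2 * Real.pi), mul_assoc, one_pow, one_div, sq]
  gcongr

lemma measurable_biotSavart : Measurable biotSavart := by
  have : biotSavart = fun z : Plane => (2 * Real.pi)⁻¹ • ((1 / ‖z‖) ^ 2 • rotPlane z) := by
    funext z; rw [biotSavart_eq, rotPlane_smul]
  rw [this]
  have hrot : Continuous rotPlane := by
    unfold rotPlane; fun_prop
  fun_prop

/-- The singular part of `‖z‖⁻¹` in the plane is in `L^q` for `q < 2`. -/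
lemma lintegral_indicator_inv_norm_rpow_ne_top {q : ℝ} (hq1 : 1 < q) (hq2 : q < 2) :
    ∫⁻ z : Plane, ENNReal.ofReal ((Set.Iio (1 : ℝ)).indicator (fun r => r⁻¹) ‖z‖) ^ q ≠ ⊤ := by
  set k : ℝ → ℝ := (Set.Iio (1 : ℝ)).indicator (fun r => r⁻¹) with hk
  have hk0 : ∀ r, 0 ≤ r → 0 ≤ k r := fun r hr => by
    simp only [hk, Set.indicator_apply]; split_ifs <;> positivity
  have hint : Integrable (fun z : Plane => k ‖z‖ ^ q) := by
    rw [integrable_fun_norm_addHaar volume (f := fun r => k r ^ q)]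
    have h1 : IntegrableOn (fun y : ℝ => y ^ (1 - q)) (Set.Ioo 0 1) := by
      have := intervalIntegral.intervalIntegrable_rpow' (a := 0) (b := 1) (r := 1 - q)
        (by linarith)
      rw [intervalIntegrable_iff_integrableOn_Ioo_of_le zero_le_one] at this
      exact this
    have h2 := (integrable_indicator_iff measurableSet_Ioo).2 h1
    refine (h2.integrableOn (s := Set.Ioi 0)).congr_fun (fun y hy => ?_) measurableSet_Ioi
    have hy' : 0 < y := hy
    by_cases hy1 : y < 1
    · have hq : y ^ (1 - q) = y * (y⁻¹) ^ q := by
        rw [Real.rpow_sub hy', Real.rpow_one, Real.inv_rpow hy'.le]; rfl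
      simp [hk, hy', hy1, hq]
    · have : q ≠ 0 := by linarith
      simp [hk, hy1, Real.zero_rpow this]
  have h3 : ∀ z : Plane, ENNReal.ofReal (k ‖z‖) ^ q = ENNReal.ofReal (k ‖z‖ ^ q) := fun z =>
    ENNReal.ofReal_rpow_of_nonneg (hk0 _ (norm_nonneg _)) (by linarith)
  simp_rw [h3]
  exact hint.lintegral_lt_top.ne

/-- The Newtonian-type potential of an `L¹ ∩ L^p` density, `p > 2`, is bounded. -/
lemma exists_lintegral_biotSavart_mul_le {p : ℝ} (hp : 2 < p) :
    ∃ c : ℝ≥0∞, c ≠ ⊤ ∧ ∀ f : Plane → ℝ≥0∞, Measurable f → ∀ x,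
      ∫⁻ y, f y * ‖biotSavart (x - y)‖ₑ ≤ (∫⁻ y, f y) + (∫⁻ y, f y ^ p) ^ (1 / p) * c := by
  have hpq : p.HolderConjugate (p / (p - 1)) := Real.HolderConjugate.conjExponent (by linarith)
  set q := p / (p - 1)
  have hq1 : 1 < q := hpq.symm.lt
  have hq2 : q < 2 := by
    simp only [q]; rw [div_lt_iff₀ (by linarith)]; linarith
  set k : ℝ → ℝ := (Set.Iio (1 : ℝ)).indicator (fun r => r⁻¹) with hk
  have hkm : Measurable k := by
    rw [hk]; exact Measurable.indicator (by fun_prop) measurableSet_Iio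
  set g : Plane → ℝ≥0∞ := fun z => ENNReal.ofReal (k ‖z‖) with hg
  have hgm : Measurable g := by fun_prop
  refine ⟨(∫⁻ z, g z ^ q) ^ (1 / q), ?_, fun f hf x => ?_⟩
  · exact ENNReal.rpow_ne_top_of_nonneg (by positivity)
      (lintegral_indicator_inv_norm_rpow_ne_top hq1 hq2)
  have hK : ∀ z : Plane, ‖biotSavart z‖ₑ ≤ 1 + g z := fun z => by
    have h1 : ‖biotSavart z‖ ≤ ‖z‖⁻¹ := by
      rw [norm_biotSavart]
      refine mul_le_of_le_one_left (by positivity) (inv_le_one_of_one_le₀ ?_)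
      linarith [Real.pi_gt_three]
    rw [← ofReal_norm]
    by_cases hz : ‖z‖ < 1
    · refine le_add_left (ENNReal.ofReal_le_ofReal ?_)
      simpa [hk, hz] using h1
    · refine le_add_right ?_
      rw [ENNReal.ofReal_le_one]
      exact h1.trans (inv_le_one_of_one_le₀ (not_lt.1 hz))
  calc ∫⁻ y, f y * ‖biotSavart (x - y)‖ₑ ≤ ∫⁻ y, (f y + (f * fun y => g (x - y)) y) := by
        refine lintegral_mono fun y => ?_
        calc f y * ‖biotSavart (x - y)‖ₑ ≤ f y * (1 + g (x - y)) := by gcongr; exact hK _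
          _ = _ := by rw [mul_add, mul_one]; rfl
    _ = (∫⁻ y, f y) + ∫⁻ y, (f * fun y => g (x - y)) y := lintegral_add_left hf _
    _ ≤ _ := by
        gcongr
        refine (ENNReal.lintegral_mul_le_Lp_mul_Lq volume hpq hf.aemeasurable
          (by fun_prop)).trans_eq ?_
        congr 2
        exact lintegral_sub_left_eq_self (fun z => g z ^ q) x

section Static

variable {ν : Measure Plane} {M : ℝ}

lemma integrable_biotSavart_sub (hM : ∀ x, ∫⁻ y, ‖biotSavart (x - y)‖ₑ ∂ν ≤ ENNReal.ofReal M)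
    (x : Plane) : Integrable (fun y => biotSavart (x - y)) ν :=
  ⟨(measurable_biotSavart.comp (by fun_prop)).aestronglyMeasurable,
    (hM x).trans_lt ENNReal.ofReal_lt_top⟩

lemma integral_norm_biotSavart_sub_le (hM0 : 0 ≤ M)
    (hM : ∀ x, ∫⁻ y, ‖biotSavart (x - y)‖ₑ ∂ν ≤ ENNReal.ofReal M) (x : Plane) :
    ∫ y, ‖biotSavart (x - y)‖ ∂ν ≤ M := by
  rw [integral_norm_eq_lintegral_enorm (integrable_biotSavart_sub hM x).1]
  exact ENNReal.toReal_le_of_le_ofReal hM0 (hM x)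

lemma norm_integral_biotSavart_sub_le (hM0 : 0 ≤ M)
    (hM : ∀ x, ∫⁻ y, ‖biotSavart (x - y)‖ₑ ∂ν ≤ ENNReal.ofReal M) (x : Plane) :
    ‖∫ y, biotSavart (x - y) ∂ν‖ ≤ M :=
  (norm_integral_le_integral_norm _).trans (integral_norm_biotSavart_sub_le hM0 hM x)

lemma stronglyMeasurable_integral_biotSavart_sub [SFinite ν] :
    StronglyMeasurable (fun x => ∫ y, biotSavart (x - y) ∂ν) := by
  have : Measurable (fun z : Plane × Plane => biotSavart (z.1 - z.2)) :=
    measurable_biotSavart.comp (by fun_prop)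
  exact this.stronglyMeasurable.integral_prod_right

/-- The self-interaction of a vortex blob against a vector field, symmetrized. -/
lemma integral_inner_biotSavart_symmetrize [SFinite ν] (hM0 : 0 ≤ M)
    (hM : ∀ x, ∫⁻ y, ‖biotSavart (x - y)‖ₑ ∂ν ≤ ENNReal.ofReal M) {G : Plane → Plane}
    (hG : Integrable G ν) :
    ∫ x, ⟪∫ y, biotSavart (x - y) ∂ν, G x⟫ ∂ν =
      ∫ z, (1 / 2 : ℝ) * ⟪biotSavart (z.1 - z.2), G z.1 - G z.2⟫ ∂(ν.prod ν) := by
  have hm : Measurable (fun z : Plane × Plane => biotSavart (z.1 - z.2)) :=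
    measurable_biotSavart.comp (by fun_prop)
  have hint : Integrable (fun z : Plane × Plane => ⟪biotSavart (z.1 - z.2), G z.1⟫)
      (ν.prod ν) := by
    have hms : AEStronglyMeasurable
        (fun z : Plane × Plane => ⟪biotSavart (z.1 - z.2), G z.1⟫) (ν.prod ν) :=
      hm.aestronglyMeasurable.inner hG.1.comp_fst
    rw [integrable_prod_iff hms]
    refine ⟨ae_of_all _ fun x => (integrable_biotSavart_sub hM x).inner_const (G x), ?_⟩
    refine (hG.norm.const_mul M).mono' hms.norm.integral_prod_right' (ae_of_all _ fun x => ?_)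
    rw [Real.norm_of_nonneg (by positivity)]
    calc ∫ y, ‖⟪biotSavart (x - y), G x⟫‖ ∂ν
        ≤ ∫ y, ‖biotSavart (x - y)‖ * ‖G x‖ ∂ν := by
          refine integral_mono_of_nonneg (ae_of_all _ fun y => norm_nonneg _)
            ((integrable_biotSavart_sub hM x).norm.mul_const _)
            (ae_of_all _ fun y => norm_inner_le_norm _ _)
      _ ≤ M * ‖G x‖ := by
          rw [integral_mul_const]
          gcongr
          exact integral_norm_biotSavart_sub_le hM0 hM x
  have h1 : ∫ x, ⟪∫ y, biotSavart (x - y) ∂ν, G x⟫ ∂ν =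
      ∫ z, ⟪biotSavart (z.1 - z.2), G z.1⟫ ∂(ν.prod ν) := by
    rw [integral_prod _ hint]
    congr 1; funext x
    rw [real_inner_comm, ← integral_inner (integrable_biotSavart_sub hM x)]
    simp_rw [real_inner_comm]
  have hint2 : Integrable (fun z : Plane × Plane => ⟪biotSavart (z.2 - z.1), G z.2⟫)
      (ν.prod ν) := hint.swap
  have h2 : ∫ z, ⟪biotSavart (z.1 - z.2), G z.1⟫ ∂(ν.prod ν) =
      ∫ z, ⟪biotSavart (z.2 - z.1), G z.2⟫ ∂(ν.prod ν) :=
    (integral_prod_swap (μ := ν) (ν := ν)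
      (fun z : Plane × Plane => ⟪biotSavart (z.1 - z.2), G z.1⟫)).symm
  have h3 : ∫ z, (1 / 2 : ℝ) * ⟪biotSavart (z.1 - z.2), G z.1 - G z.2⟫ ∂(ν.prod ν) =
      (1 / 2 : ℝ) * (∫ z, ⟪biotSavart (z.1 - z.2), G z.1⟫ ∂(ν.prod ν) +
        ∫ z, ⟪biotSavart (z.2 - z.1), G z.2⟫ ∂(ν.prod ν)) := by
    rw [← integral_add hint hint2, ← integral_const_mul]
    congr 1; funext z
    rw [← neg_sub z.1 z.2, biotSavart_neg, inner_neg_left, inner_sub_right]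
    ring
  rw [h1, h3, ← h2]; ring

end Static

lemma norm_gradient_eq (φ : Plane → ℝ) (x : Plane) : ‖gradient φ x‖ = ‖fderiv ℝ φ x‖ := by
  simp [gradient]

lemma gradient_comp_sub_const (φ : Plane → ℝ) (z x : Plane) :
    gradient (fun y => φ (y - z)) x = gradient φ (x - z) := by
  simp only [gradient, fderiv_comp_sub]

lemma continuous_gradient {φ : Plane → ℝ} (hφ : ContDiff ℝ 1 φ) : Continuous (gradient φ) :=
  (InnerProductSpace.toDual ℝ Plane).symm.continuous.comp (hφ.continuous_fderiv one_ne_zero)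

lemma norm_gradient_sub (φ : Plane → ℝ) (x y : Plane) :
    ‖gradient φ x - gradient φ y‖ = ‖fderiv ℝ φ x - fderiv ℝ φ y‖ := by
  rw [gradient, gradient, ← map_sub, LinearIsometryEquiv.norm_map]

/-- Continuous functions are integrable against finite measures of bounded support. -/
lemma Continuous.integrable_of_ae_norm_le {F : Type*} [NormedAddCommGroup F]
    [SecondCountableTopology F] [MeasurableSpace F] [BorelSpace F] {ν : Measure Plane}
    [IsFiniteMeasure ν] {r : ℝ} (hr : ∀ᵐ x ∂ν, ‖x‖ ≤ r) {g : Plane → F} (hg : Continuous g) :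
    Integrable g ν := by
  obtain ⟨c, hc⟩ := (isCompact_closedBall (0 : Plane) r).exists_bound_of_continuousOn
    hg.continuousOn
  refine MeasureTheory.Integrable.of_bound hg.measurable.aestronglyMeasurable c ?_
  filter_upwards [hr] with x hx
  exact hc x (by simpa using hx)

/-- Normalized vorticity measures `ν i t` of unit mass, moved by the velocity field that they
generate with intensities `a i`. -/
structure IsVortexFlow {N : ℕ} (a : Fin N → ℝ) (ν : Fin N → ℝ → Measure Plane)
    (u : ℝ → Plane → Plane) (M : ℝ) : Prop where
  nonneg : 0 ≤ M
  prob : ∀ i t, 0 ≤ t → IsProbabilityMeasure (ν i t)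
  bounded : ∀ i t, 0 ≤ t → ∃ r, ∀ᵐ x ∂ν i t, ‖x‖ ≤ r
  potential : ∀ i t, 0 ≤ t → ∀ x, ∫⁻ y, ‖biotSavart (x - y)‖ₑ ∂ν i t ≤ ENNReal.ofReal M
  velocity : ∀ t, 0 ≤ t → ∀ x, u t x = ∑ j, a j • ∫ y, biotSavart (x - y) ∂ν j t
  weak : ∀ i (φ : Plane → ℝ), ContDiff ℝ 1 φ → (∃ B, ∀ x, ‖gradient φ x‖ ≤ B) → ∀ t, 0 ≤ t →
    HasDerivWithinAt (fun s => ∫ x, φ x ∂ν i s) (∫ x, ⟪u t x, gradient φ x⟫ ∂ν i t)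
      (Set.Ici 0) t

namespace IsVortexFlow

variable {N : ℕ} {a : Fin N → ℝ} {ν : Fin N → ℝ → Measure Plane} {u : ℝ → Plane → Plane} {M : ℝ}

lemma integrable_of_continuous (H : IsVortexFlow a ν u M) {F : Type*} [NormedAddCommGroup F]
    [SecondCountableTopology F] [MeasurableSpace F] [BorelSpace F] (i : Fin N) {t : ℝ}
    (ht : 0 ≤ t) {g : Plane → F} (hg : Continuous g) : Integrable g (ν i t) := by
  have := H.prob i t ht
  obtain ⟨r, hr⟩ := H.bounded i t ht
  exact hg.integrable_of_ae_norm_le hr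

lemma stronglyMeasurable_velocity (H : IsVortexFlow a ν u M) {t : ℝ} (ht : 0 ≤ t) :
    StronglyMeasurable (u t) := by
  have : u t = fun x => ∑ j, a j • ∫ y, biotSavart (x - y) ∂ν j t := funext (H.velocity t ht)
  rw [this]
  refine Finset.stronglyMeasurable_fun_sum _ fun j _ => ?_
  have := H.prob j t ht
  exact stronglyMeasurable_integral_biotSavart_sub.const_smul (a j)

lemma norm_velocity_le (H : IsVortexFlow a ν u M) {t : ℝ} (ht : 0 ≤ t) (x : Plane) :
    ‖u t x‖ ≤ (∑ j, |a j|) * M := by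
  rw [H.velocity t ht, Finset.sum_mul]
  refine norm_sum_le_of_le _ fun j _ => ?_
  rw [norm_smul, Real.norm_eq_abs]
  gcongr
  exact norm_integral_biotSavart_sub_le H.nonneg (H.potential j t ht) x

lemma integrable_velocity (H : IsVortexFlow a ν u M) (i : Fin N) {t : ℝ} (ht : 0 ≤ t) :
    Integrable (u t) (ν i t) := by
  have := H.prob i t ht
  exact MeasureTheory.Integrable.of_bound (H.stronglyMeasurable_velocity ht).aestronglyMeasurable _
    (ae_of_all _ (H.norm_velocity_le ht))

lemma integrable_inner_velocity (H : IsVortexFlow a ν u M) (i : Fin N) {t : ℝ} (ht : 0 ≤ t)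
    {G : Plane → Plane} (hG : Integrable G (ν i t)) :
    Integrable (fun x => ⟪u t x, G x⟫) (ν i t) := by
  refine (hG.norm.const_mul ((∑ j, |a j|) * M)).mono'
    ((H.stronglyMeasurable_velocity ht).aestronglyMeasurable.inner hG.1) (ae_of_all _ fun x => ?_)
  exact (norm_inner_le_norm _ _).trans
    (mul_le_mul_of_nonneg_right (H.norm_velocity_le ht x) (norm_nonneg _))

lemma hasDerivWithinAt_center (H : IsVortexFlow a ν u M) (i : Fin N) {t : ℝ} (ht : 0 ≤ t) :
    HasDerivWithinAt (fun s => ∫ x, x ∂ν i s) (∫ x, u t x ∂ν i t) (Set.Ici 0) t := by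
  rw [hasDerivWithinAt_iff_hasFDerivWithinAt, hasFDerivWithinAt_euclidean]
  intro k
  set e : Plane := EuclideanSpace.single k 1
  have hgrad : ∀ x : Plane, gradient (fun y : Plane => ⟪e, y⟫) x = e := fun x => by
    refine HasGradientAt.gradient ?_
    rw [hasGradientAt_iff_hasFDerivAt]
    exact (InnerProductSpace.toDual ℝ Plane e).hasFDerivAt
  have hcoord : ∀ y : Plane, ⟪e, y⟫ = y k := fun y => by
    simp [e, EuclideanSpace.inner_single_left]
  have h := H.weak i (fun y : Plane => ⟪e, y⟫) (contDiff_const.inner ℝ contDiff_id)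
    ⟨‖e‖, fun x => by rw [hgrad]⟩ t ht
  have h' : HasDerivWithinAt (fun s => (∫ x, x ∂ν i s) k) ((∫ x, u t x ∂ν i t) k)
      (Set.Ici 0) t := by
    simp only [hgrad] at h
    have h1 : ∫ x, ⟪u t x, e⟫ ∂ν i t = (∫ x, u t x ∂ν i t) k := by
      rw [← hcoord, ← integral_inner (H.integrable_velocity i ht)]
      simp_rw [real_inner_comm]
    rw [h1] at h
    refine h.congr_of_mem (fun s hs => ?_) ht
    rw [← hcoord]
    exact (integral_inner (H.integrable_of_continuous i hs continuous_id) e).symm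
  refine h'.hasFDerivWithinAt.congr_fderiv ?_
  ext; simp

/-- Transport of test functions translated along a moving point. -/
lemma hasDerivWithinAt_integral_translate (H : IsVortexFlow a ν u M) (i : Fin N)
    {φ : Plane → ℝ} (hφ : ContDiff ℝ 2 φ) {B₁ B₂ : ℝ} (hB₁ : ∀ x, ‖fderiv ℝ φ x‖ ≤ B₁)
    (hB₂0 : 0 ≤ B₂) (hB₂ : ∀ x y, ‖fderiv ℝ φ x - fderiv ℝ φ y‖ ≤ B₂ * ‖x - y‖)
    {z : ℝ → Plane} {v : Plane} {t : ℝ} (ht : 0 ≤ t)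
    (hz : HasDerivWithinAt z v (Set.Ici 0) t) :
    HasDerivWithinAt (fun s => ∫ x, φ (x - z s) ∂ν i s)
      (∫ x, ⟪u t x - v, gradient φ (x - z t)⟫ ∂ν i t) (Set.Ici 0) t := by
  have hφd : Differentiable ℝ φ := hφ.differentiable two_ne_zero
  have hφc : Continuous φ := hφ.continuous
  have hφ1 : ContDiff ℝ 1 φ := hφ.of_le (by norm_num)
  have hdφ : ContDiff ℝ 1 (fderiv ℝ φ) := hφ.fderiv_right (by norm_num)
  set e : Fin 2 → Plane := fun k => EuclideanSpace.single k 1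
  have hexp : ∀ (x w : Plane), fderiv ℝ φ x w = ∑ k, w k * fderiv ℝ φ x (e k) := fun x w => by
    conv_lhs => rw [← (EuclideanSpace.basisFun (Fin 2) ℝ).sum_repr w, map_sum]
    simp [e]
  -- the part with frozen translation
  have hP : HasDerivWithinAt (fun s => ∫ x, φ (x - z t) ∂ν i s)
      (∫ x, ⟪u t x, gradient φ (x - z t)⟫ ∂ν i t) (Set.Ici 0) t := by
    have := H.weak i (fun x => φ (x - z t)) (hφ1.comp (by fun_prop))
      ⟨B₁, fun x => by rw [gradient_comp_sub_const, norm_gradient_eq]; exact hB₁ _⟩ t ht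
    simpa only [gradient_comp_sub_const] using this
  -- the first-order effect of the translation
  set g : Fin 2 → ℝ → ℝ := fun k s => ∫ x, fderiv ℝ φ (x - z t) (e k) ∂ν i s
  have hg : ∀ k, ∃ g', HasDerivWithinAt (g k) g' (Set.Ici 0) t := fun k => by
    have hC1 : ContDiff ℝ 1 (fun x => fderiv ℝ φ (x - z t) (e k)) :=
      (hdφ.comp (by fun_prop : ContDiff ℝ 1 fun x : Plane => x - z t)).clm_apply contDiff_const
    refine ⟨_, H.weak i _ hC1 ⟨B₂.toNNReal, fun x => ?_⟩ t ht⟩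
    rw [norm_gradient_eq]
    refine norm_fderiv_le_of_lipschitz ℝ (LipschitzWith.of_dist_le_mul fun x y => ?_)
    rw [dist_eq_norm, dist_eq_norm, ← sub_apply, Real.coe_toNNReal _ hB₂0]
    refine (ContinuousLinearMap.le_opNorm _ _).trans ?_
    simpa [e] using hB₂ (x - z t) (y - z t)
  choose g' hg' using hg
  have hzk : ∀ k, HasDerivWithinAt (fun s => (z s - z t) k) (v k) (Set.Ici 0) t := fun k => by
    have := (hasFDerivWithinAt_euclidean.1 (hz.sub_const (z t)).hasFDerivWithinAt k)
      |>.hasDerivWithinAt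
    simpa using this
  have hQ : HasDerivWithinAt (fun s => ∑ k, (z s - z t) k * g k s) (∑ k, v k * g k t)
      (Set.Ici 0) t := by
    have := HasDerivWithinAt.fun_sum (u := Finset.univ) fun k _ => (hzk k).mul (hg' k)
    simpa using this
  have hint : ∀ {s}, 0 ≤ s → ∀ w, Integrable (fun x => fderiv ℝ φ (x - z t) w) (ν i s) :=
    fun hs w => H.integrable_of_continuous i hs
      ((hdφ.continuous.comp (by fun_prop)).clm_apply continuous_const)
  have hsum : ∀ {s}, 0 ≤ s → ∀ w : Plane,
      ∑ k, w k * g k s = ∫ x, fderiv ℝ φ (x - z t) w ∂ν i s := fun {s} hs w => by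
    simp_rw [hexp _ w, g, ← integral_const_mul]
    rw [integral_finsetSum _ fun k _ => (hint hs (e k)).const_mul (w k)]
  -- the quadratic remainder
  set rem : ℝ → ℝ := fun s => ∫ x, (φ (x - z s) - φ (x - z t) + fderiv ℝ φ (x - z t) (z s - z t))
    ∂ν i s
  have hintφ : ∀ {s}, 0 ≤ s → ∀ w, Integrable (fun x => φ (x - w)) (ν i s) :=
    fun hs w => H.integrable_of_continuous i hs (hφc.comp (by fun_prop))
  have htaylor : ∀ y w : Plane, ‖φ (y - w) - φ y + fderiv ℝ φ y w‖ ≤ B₂ * ‖w‖ ^ 2 := by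
    intro y w
    have h := Convex.norm_image_sub_le_of_norm_fderiv_le' (𝕜 := ℝ) (f := φ) (C := B₂ * ‖w‖)
      (s := Metric.closedBall y ‖w‖) (x := y) (y := y - w) (φ := fderiv ℝ φ y)
      (fun x _ => hφd x) (fun x hx => (hB₂ x y).trans ?_) (convex_closedBall _ _)
      (by simp) (by simp)
    · simpa [sq, mul_assoc] using h
    · gcongr
      simpa [dist_eq_norm] using hx
  have hremle : ∀ s, 0 ≤ s → ‖rem s‖ ≤ B₂ * ‖z s - z t‖ ^ 2 := fun s hs => by
    have := H.prob i s hs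
    have h := norm_integral_le_of_norm_le_const (μ := ν i s)
      (f := fun x => φ (x - z s) - φ (x - z t) + fderiv ℝ φ (x - z t) (z s - z t))
      (C := B₂ * ‖z s - z t‖ ^ 2) (ae_of_all _ fun x => by
        have := htaylor (x - z t) (z s - z t)
        rwa [sub_sub_sub_cancel_right] at this)
    rwa [probReal_univ, mul_one] at h
  have hrem : HasDerivWithinAt rem 0 (Set.Ici 0) t := by
    have hO : rem =O[nhdsWithin t (Set.Ici 0)] fun s => ‖s - t‖ ^ 2 := by
      have h1 : rem =O[nhdsWithin t (Set.Ici 0)] fun s => ‖z s - z t‖ ^ 2 := by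
        refine Asymptotics.IsBigO.of_bound B₂ ?_
        filter_upwards [self_mem_nhdsWithin] with s hs
        simpa using hremle s hs
      exact h1.trans (hz.differentiableWithinAt.isBigO_sub.norm_norm.pow 2)
    have := hO.hasFDerivWithinAt (𝕜 := ℝ) (by exact ht) one_lt_two
    rw [hasDerivWithinAt_iff_hasFDerivWithinAt]
    refine this.congr_fderiv ?_
    ext; simp
  have htot := (hP.sub hQ).add hrem
  have hval : (∫ x, ⟪u t x - v, gradient φ (x - z t)⟫ ∂ν i t) =
      (∫ x, ⟪u t x, gradient φ (x - z t)⟫ ∂ν i t) - ∑ k, v k * g k t + 0 := by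
    have hG : Integrable (fun x => gradient φ (x - z t)) (ν i t) :=
      H.integrable_of_continuous i ht ((continuous_gradient hφ1).comp (by fun_prop))
    rw [hsum ht, add_zero, ← integral_sub (H.integrable_inner_velocity i ht hG) (hint ht v)]
    congr 1; funext x
    rw [inner_sub_left, ← inner_gradient_left, real_inner_comm v]
  rw [hval]
  refine htot.congr_of_mem (fun s hs => ?_) ht
  simp only [Pi.add_apply, Pi.sub_apply, rem]
  rw [hsum hs, integral_add (f := fun x => φ (x - z s) - φ (x - z t))
    ((hintφ hs _).sub (hintφ hs _)) (hint hs _), integral_sub (hintφ hs _) (hintφ hs _)]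
  ring

lemma ae_inner_le (H : IsVortexFlow a ν u M) (i : Fin N) {e : Plane} (he : ‖e‖ = 1) {r : ℝ}
    (hr : ∀ᵐ x ∂ν i 0, ‖x‖ ≤ r) {t : ℝ} (ht : 0 ≤ t) :
    ∀ᵐ x ∂ν i t, ⟪e, x⟫ ≤ r + (∑ j, |a j|) * M * t := by
  set U := (∑ j, |a j|) * M
  have hθ : ∀ n : ℕ∞, ContDiff ℝ n Real.smoothTransition := fun n =>
    Real.smoothTransition.contDiff
  set θ' := deriv Real.smoothTransition with hθ'
  have hθ'1 : ContDiff ℝ 1 θ' := (contDiff_succ_iff_deriv.1 (hθ 2)).2.2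
  have hθ'0 : ∀ s, 0 ≤ θ' s := fun s => Real.smoothTransition.monotone.deriv_nonneg
  have hsupp : HasCompactSupport θ' := by
    refine HasCompactSupport.intro (isCompact_Icc (a := 0) (b := 1)) fun s hs => ?_
    rw [Set.mem_Icc, not_and_or, not_le, not_le] at hs
    rcases hs with hs | hs
    · have : Real.smoothTransition =ᶠ[nhds s] fun _ => 0 := by
        filter_upwards [Iio_mem_nhds hs] with y hy
        exact Real.smoothTransition.zero_of_nonpos (le_of_lt hy)
      rw [hθ', this.deriv_eq]; simp
    · have : Real.smoothTransition =ᶠ[nhds s] fun _ => 1 := by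
        filter_upwards [Ioi_mem_nhds hs] with y hy
        exact Real.smoothTransition.one_of_one_le (le_of_lt hy)
      rw [hθ', this.deriv_eq]; simp
  obtain ⟨B₁, hB₁⟩ := hsupp.exists_bound_of_continuous hθ'1.continuous
  obtain ⟨B₂, hB₂⟩ := hθ'1.lipschitzWith_of_hasCompactSupport hsupp one_ne_zero
  set φ : Plane → ℝ := fun x => Real.smoothTransition (⟪e, x⟫ - r) with hφ
  have hinner : ContDiff ℝ 2 fun x : Plane => ⟪e, x⟫ - r :=
    (contDiff_const.inner ℝ contDiff_id).sub contDiff_const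
  have hφC : ContDiff ℝ 2 φ := (hθ 2).comp hinner
  have hfd : ∀ x, HasFDerivAt φ (θ' (⟪e, x⟫ - r) • InnerProductSpace.toDual ℝ Plane e) x :=
    fun x => by
      have h1 : HasDerivAt Real.smoothTransition (θ' (⟪e, x⟫ - r)) (⟪e, x⟫ - r) :=
        ((hθ 1).differentiable one_ne_zero _).hasDerivAt
      have h2 : HasFDerivAt (fun x : Plane => ⟪e, x⟫ - r) (InnerProductSpace.toDual ℝ Plane e) x :=
        (InnerProductSpace.toDual ℝ Plane e).hasFDerivAt.sub_const r
      exact h1.comp_hasFDerivAt x h2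
  have hgrad : ∀ x, gradient φ x = θ' (⟪e, x⟫ - r) • e := fun x => by
    refine HasGradientAt.gradient ?_
    rw [hasGradientAt_iff_hasFDerivAt, map_smul]
    exact hfd x
  have hz : ∀ s, HasDerivAt (fun s : ℝ => (U * s) • e) (U • e) s := fun s => by
    simpa using ((hasDerivAt_id s).const_mul U).smul_const e
  have hD : ∀ s, 0 ≤ s → HasDerivWithinAt (fun s => ∫ x, φ (x - (U * s) • e) ∂ν i s)
      (∫ x, ⟪u s x - U • e, gradient φ (x - (U * s) • e)⟫ ∂ν i s) (Set.Ici 0) s := fun s hs => by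
    refine H.hasDerivWithinAt_integral_translate i hφC (B₁ := B₁) (B₂ := B₂) (fun x => ?_)
      B₂.2 (fun x y => ?_) hs (hz s).hasDerivWithinAt
    · rw [(hfd x).fderiv, norm_smul, LinearIsometryEquiv.norm_map, he, mul_one]
      exact hB₁ _
    · rw [(hfd x).fderiv, (hfd y).fderiv, ← sub_smul, norm_smul, LinearIsometryEquiv.norm_map,
        he, mul_one]
      refine (hB₂.norm_sub_le _ _).trans ?_
      gcongr
      rw [sub_sub_sub_cancel_right, ← inner_sub_right]
      simpa [he] using norm_inner_le_norm (𝕜 := ℝ) e (x - y)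
  have hanti : AntitoneOn (fun s => ∫ x, φ (x - (U * s) • e) ∂ν i s) (Set.Ici 0) := by
    refine antitoneOn_of_hasDerivWithinAt_nonpos (convex_Ici 0)
      (fun s hs => (hD s hs).continuousWithinAt)
      (fun s hs => (hD s (interior_subset hs)).mono interior_subset) fun s hs => ?_
    refine integral_nonpos fun x => ?_
    have hs0 : 0 ≤ s := interior_subset hs
    simp only [hgrad, inner_smul_right, inner_sub_left, inner_smul_left, real_inner_self_eq_norm_sq,
      he]
    refine mul_nonpos_of_nonneg_of_nonpos (hθ'0 _) ?_
    have h1 := real_inner_le_norm (u s x) e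
    have h2 := H.norm_velocity_le hs0 x
    rw [he, mul_one] at h1
    simpa using h1.trans h2
  have h0 : ∫ x, φ (x - (U * 0) • e) ∂ν i 0 = 0 := by
    refine integral_eq_zero_of_ae ?_
    filter_upwards [hr] with x hx
    refine Real.smoothTransition.zero_of_nonpos ?_
    have := real_inner_le_norm e x
    rw [he, one_mul] at this
    simpa using this.trans hx
  have h1 := hanti (Set.mem_Ici.2 le_rfl) ht ht
  simp only [h0] at h1
  have hint : Integrable (fun x => φ (x - (U * t) • e)) (ν i t) :=
    H.integrable_of_continuous i ht (hφC.continuous.comp (by fun_prop))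
  have hnn : 0 ≤ fun x => φ (x - (U * t) • e) := fun x => Real.smoothTransition.nonneg _
  have h2 := (integral_eq_zero_iff_of_nonneg hnn hint).1 (le_antisymm h1 (integral_nonneg hnn))
  filter_upwards [h2] with x hx
  have h3 := Real.smoothTransition.zero_iff_nonpos.1 hx
  rw [inner_sub_right, inner_smul_right, real_inner_self_eq_norm_sq, he] at h3
  linarith

/-- The support of each blob stays in a fixed ball on bounded time intervals. -/
lemma exists_uniform_bound (H : IsVortexFlow a ν u M) (i : Fin N) (T : ℝ) :
    ∃ r, ∀ t, 0 ≤ t → t ≤ T → ∀ᵐ x ∂ν i t, ‖x‖ ≤ r := by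
  obtain ⟨r, hr⟩ := H.bounded i 0 le_rfl
  have hU : 0 ≤ (∑ j, |a j|) * M := mul_nonneg (Finset.sum_nonneg fun j _ => abs_nonneg _) H.nonneg
  refine ⟨(r + (∑ j, |a j|) * M * T) + (r + (∑ j, |a j|) * M * T), fun t ht htT => ?_⟩
  have hle : r + (∑ j, |a j|) * M * t ≤ r + (∑ j, |a j|) * M * T := by gcongr
  have key : ∀ k : Fin 2, ∀ᵐ x ∂ν i t, |x k| ≤ r + (∑ j, |a j|) * M * T := fun k => by
    have h1 := H.ae_inner_le i (e := EuclideanSpace.single k (1 : ℝ)) (by simp) hr ht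
    have h2 := H.ae_inner_le i (e := -EuclideanSpace.single k (1 : ℝ)) (by simp) hr ht
    filter_upwards [h1, h2] with x hx1 hx2
    rw [inner_neg_left] at hx2
    simp only [EuclideanSpace.inner_single_left, map_one, one_mul] at hx1 hx2
    exact abs_le.2 ⟨by linarith, by linarith⟩
  filter_upwards [key 0, key 1] with x h0 h1
  calc ‖x‖ ≤ |x 0| + |x 1| := by
        rw [EuclideanSpace.norm_eq, Fin.sum_univ_two, Real.norm_eq_abs, Real.norm_eq_abs]
        exact Real.sqrt_le_iff.2 ⟨by positivity, by nlinarith [abs_nonneg (x 0), abs_nonneg (x 1)]⟩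
    _ ≤ _ := add_le_add h0 h1

lemma hasDerivWithinAt_integral_norm_sq (H : IsVortexFlow a ν u M) (i : Fin N) {t T : ℝ}
    (ht : t ∈ Set.Icc 0 T) :
    HasDerivWithinAt (fun s => ∫ x, ‖x‖ ^ 2 ∂ν i s) (∫ x, 2 * ⟪u t x, x⟫ ∂ν i t)
      (Set.Icc 0 T) t := by
  obtain ⟨r, hr⟩ := H.exists_uniform_bound i T
  let b : ContDiffBump (0 : Plane) := ⟨|r| + 1, |r| + 2, by positivity, by linarith⟩
  have hb : ∀ x : Plane, ‖x‖ < |r| + 1 → b x * ‖x‖ ^ 2 = ‖x‖ ^ 2 := fun x hx => by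
    rw [b.one_of_mem_closedBall (by simpa [b] using hx.le), one_mul]
  have hC : ContDiff ℝ 1 fun x : Plane => b x * ‖x‖ ^ 2 := b.contDiff.mul (contDiff_norm_sq ℝ)
  have hsupp : HasCompactSupport fun x : Plane => b x * ‖x‖ ^ 2 :=
    b.hasCompactSupport.mul_right
  obtain ⟨B, hB⟩ := (hsupp.fderiv ℝ).exists_bound_of_continuous
    (hC.continuous_fderiv one_ne_zero)
  have hgrad : ∀ x : Plane, ‖x‖ < |r| + 1 →
      gradient (fun x : Plane => b x * ‖x‖ ^ 2) x = (2 : ℝ) • x := fun x hx => by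
    have heq : (fun x : Plane => b x * ‖x‖ ^ 2) =ᶠ[nhds x] fun x => ‖x‖ ^ 2 := by
      filter_upwards [(isOpen_lt continuous_norm continuous_const).mem_nhds hx] with y hy
      exact hb y hy
    rw [heq.gradient_eq]
    refine HasGradientAt.gradient ?_
    rw [hasGradientAt_iff_hasFDerivAt]
    refine (hasStrictFDerivAt_norm_sq x).hasFDerivAt.congr_fderiv ?_
    ext y; simp [two_mul]
  have h := (H.weak i _ hC ⟨B, fun x => (norm_gradient_eq _ x).trans_le (hB x)⟩ t ht.1).mono
    (Set.Icc_subset_Ici_self : Set.Icc 0 T ⊆ Set.Ici 0)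
  have hlt : ∀ {x : Plane}, ‖x‖ ≤ r → ‖x‖ < |r| + 1 := fun {x} hx => by
    linarith [le_abs_self r]
  have hval : ∫ x, ⟪u t x, gradient (fun x : Plane => b x * ‖x‖ ^ 2) x⟫ ∂ν i t =
      ∫ x, 2 * ⟪u t x, x⟫ ∂ν i t := by
    refine integral_congr_ae ?_
    filter_upwards [hr t ht.1 ht.2] with x hx
    rw [hgrad x (hlt hx), inner_smul_right]
  rw [hval] at h
  refine h.congr_of_mem (fun s hs => integral_congr_ae ?_) ht
  filter_upwards [hr s hs.1 hs.2] with x hx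
  exact (hb x (hlt hx)).symm

lemma hasDerivWithinAt_moment (H : IsVortexFlow a ν u M) (i : Fin N) {t T : ℝ}
    (ht : t ∈ Set.Icc 0 T) :
    HasDerivWithinAt (fun s => ∫ x, ‖x - ∫ y, y ∂ν i s‖ ^ 2 ∂ν i s)
      (2 * ∫ x, ⟪u t x, x - ∫ y, y ∂ν i t⟫ ∂ν i t) (Set.Icc 0 T) t := by
  have h1 := H.hasDerivWithinAt_integral_norm_sq i ht
  have h2 := ((H.hasDerivWithinAt_center i ht.1).mono
    (Set.Icc_subset_Ici_self : Set.Icc 0 T ⊆ Set.Ici 0)).norm_sq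
  have hx : ∀ {s}, 0 ≤ s → Integrable (fun x : Plane => x) (ν i s) := fun hs =>
    H.integrable_of_continuous i hs continuous_id
  have hval : 2 * ∫ x, ⟪u t x, x - ∫ y, y ∂ν i t⟫ ∂ν i t =
      (∫ x, 2 * ⟪u t x, x⟫ ∂ν i t) - 2 * ⟪∫ y, y ∂ν i t, ∫ x, u t x ∂ν i t⟫ := by
    rw [← integral_inner (H.integrable_velocity i ht.1), ← integral_const_mul,
      ← integral_const_mul, ← integral_sub]
    · congr 1; funext x
      rw [inner_sub_right, real_inner_comm (u t x) (∫ y, y ∂ν i t)]; ring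
    · exact (H.integrable_inner_velocity i ht.1 (hx ht.1)).const_mul 2
    · exact ((H.integrable_velocity i ht.1).const_inner _).const_mul 2
  rw [hval]
  refine (h1.sub h2).congr_of_mem (fun s hs => ?_) ht
  have := H.prob i s hs.1
  set X := ∫ y, y ∂ν i s with hX
  have hsq : Integrable (fun x : Plane => ‖x‖ ^ 2) (ν i s) :=
    H.integrable_of_continuous i hs.1 (by fun_prop)
  have hin : Integrable (fun x : Plane => 2 * ⟪X, x⟫) (ν i s) :=
    ((hx hs.1).const_inner X).const_mul 2
  calc ∫ x, ‖x - X‖ ^ 2 ∂ν i s = ∫ x, (‖x‖ ^ 2 - 2 * ⟪X, x⟫ + ‖X‖ ^ 2) ∂ν i s := by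
        congr 1; funext x
        rw [norm_sub_sq_real, real_inner_comm]
    _ = _ := by
        rw [integral_add (f := fun x => ‖x‖ ^ 2 - 2 * ⟪X, x⟫) (hsq.sub hin) (integrable_const _),
          integral_sub hsq hin, integral_const_mul, integral_inner (hx hs.1), ← hX,
          real_inner_self_eq_norm_sq]
        simp
        ring

end IsVortexFlow

/-- The velocity generated by all the blobs except the `i`-th. -/
noncomputable def externalField {N : ℕ} (a : Fin N → ℝ) (ν : Fin N → ℝ → Measure Plane)
    (i : Fin N) (t : ℝ) (x : Plane) : Plane :=
  ∑ j ∈ Finset.univ.erase i, a j • ∫ y, biotSavart (x - y) ∂ν j t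

/-- The `i`-th blob is at distance at least `d` from all the others at time `t`. -/
def IsSeparated {N : ℕ} (ν : Fin N → ℝ → Measure Plane) (i : Fin N) (t d : ℝ) : Prop :=
  ∀ᵐ x ∂ν i t, ∀ j, j ≠ i → ∀ᵐ y ∂ν j t, d ≤ ‖x - y‖

namespace IsVortexFlow

variable {N : ℕ} {a : Fin N → ℝ} {ν : Fin N → ℝ → Measure Plane} {u : ℝ → Plane → Plane} {M : ℝ}

lemma norm_externalField_le (H : IsVortexFlow a ν u M) {i : Fin N} {t d : ℝ} (ht : 0 ≤ t)
    (hd : 0 < d) {x : Plane} (hx : ∀ j, j ≠ i → ∀ᵐ y ∂ν j t, d ≤ ‖x - y‖) :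
    ‖externalField a ν i t x‖ ≤ (∑ j, |a j|) * (2 * Real.pi * d)⁻¹ := by
  have hpi := Real.pi_pos
  calc ‖externalField a ν i t x‖ ≤ ∑ j ∈ Finset.univ.erase i, |a j| * (2 * Real.pi * d)⁻¹ := by
        refine norm_sum_le_of_le _ fun j hj => ?_
        have := H.prob j t ht
        rw [norm_smul, Real.norm_eq_abs]
        gcongr
        have h := norm_integral_le_of_norm_le_const (μ := ν j t)
          (f := fun y => biotSavart (x - y)) (C := (2 * Real.pi * d)⁻¹) (by
            filter_upwards [hx j (Finset.ne_of_mem_erase hj)] with y hy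
            exact norm_biotSavart_le hd hy)
        rwa [probReal_univ, mul_one] at h
    _ ≤ ∑ j, |a j| * (2 * Real.pi * d)⁻¹ :=
        Finset.sum_le_sum_of_subset_of_nonneg (Finset.erase_subset _ _)
          fun j _ _ => by positivity
    _ = _ := (Finset.sum_mul _ _ _).symm

lemma norm_externalField_sub_le (H : IsVortexFlow a ν u M) {i : Fin N} {t d : ℝ} (ht : 0 ≤ t)
    (hd : 0 < d) {x y : Plane} (hx : ∀ j, j ≠ i → ∀ᵐ w ∂ν j t, d ≤ ‖x - w‖)
    (hy : ∀ j, j ≠ i → ∀ᵐ w ∂ν j t, d ≤ ‖y - w‖) :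
    ‖externalField a ν i t x - externalField a ν i t y‖ ≤
      (∑ j, |a j|) * (2 * Real.pi * d ^ 2)⁻¹ * ‖x - y‖ := by
  have hpi := Real.pi_pos
  calc ‖externalField a ν i t x - externalField a ν i t y‖
      ≤ ∑ j ∈ Finset.univ.erase i, |a j| * ((2 * Real.pi * d ^ 2)⁻¹ * ‖x - y‖) := by
        rw [externalField, externalField, ← Finset.sum_sub_distrib]
        refine norm_sum_le_of_le _ fun j hj => ?_
        have := H.prob j t ht
        have hj' := Finset.ne_of_mem_erase hj
        rw [← smul_sub, norm_smul, Real.norm_eq_abs,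
          ← integral_sub (integrable_biotSavart_sub (H.potential j t ht) x)
            (integrable_biotSavart_sub (H.potential j t ht) y)]
        gcongr
        have h := norm_integral_le_of_norm_le_const (μ := ν j t)
          (f := fun w => biotSavart (x - w) - biotSavart (y - w))
          (C := (2 * Real.pi * d ^ 2)⁻¹ * ‖x - y‖) (by
            filter_upwards [hx j hj', hy j hj'] with w hxw hyw
            simpa using norm_biotSavart_sub_le hd hxw hyw)
        rwa [probReal_univ, mul_one] at h
    _ ≤ ∑ j, |a j| * ((2 * Real.pi * d ^ 2)⁻¹ * ‖x - y‖) :=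
        Finset.sum_le_sum_of_subset_of_nonneg (Finset.erase_subset _ _)
          fun j _ _ => by positivity
    _ = _ := by rw [← Finset.sum_mul, ← mul_assoc]

lemma velocity_eq_add_externalField (H : IsVortexFlow a ν u M) (i : Fin N) {t : ℝ} (ht : 0 ≤ t)
    (x : Plane) :
    u t x = a i • (∫ y, biotSavart (x - y) ∂ν i t) + externalField a ν i t x := by
  rw [H.velocity t ht, externalField]
  exact (Finset.add_sum_erase _ (fun j => a j • ∫ y, biotSavart (x - y) ∂ν j t)
    (Finset.mem_univ i)).symm

lemma integrable_self_velocity (H : IsVortexFlow a ν u M) (i : Fin N) {t : ℝ} (ht : 0 ≤ t) :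
    Integrable (fun x => ∫ y, biotSavart (x - y) ∂ν i t) (ν i t) := by
  have := H.prob i t ht
  exact MeasureTheory.Integrable.of_bound
    stronglyMeasurable_integral_biotSavart_sub.aestronglyMeasurable M
    (ae_of_all _ (norm_integral_biotSavart_sub_le H.nonneg (H.potential i t ht)))

lemma integrable_inner_self_velocity (H : IsVortexFlow a ν u M) (i : Fin N) {t : ℝ} (ht : 0 ≤ t)
    {G : Plane → Plane} (hG : Integrable G (ν i t)) :
    Integrable (fun x => ⟪∫ y, biotSavart (x - y) ∂ν i t, G x⟫) (ν i t) := by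
  refine (hG.norm.const_mul M).mono' ((H.integrable_self_velocity i ht).1.inner hG.1)
    (ae_of_all _ fun x => (norm_inner_le_norm _ _).trans ?_)
  gcongr
  exact norm_integral_biotSavart_sub_le H.nonneg (H.potential i t ht) x

lemma integrable_externalField (H : IsVortexFlow a ν u M) (i : Fin N) {t : ℝ} (ht : 0 ≤ t) :
    Integrable (externalField a ν i t) (ν i t) := by
  refine ((H.integrable_velocity i ht).sub
    ((H.integrable_self_velocity i ht).smul (a i))).congr (ae_of_all _ fun x => ?_)
  simp [H.velocity_eq_add_externalField i ht]

lemma integrable_inner_externalField (H : IsVortexFlow a ν u M) (i : Fin N) {t : ℝ} (ht : 0 ≤ t)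
    {G : Plane → Plane} (hG : Integrable G (ν i t)) :
    Integrable (fun x => ⟪externalField a ν i t x, G x⟫) (ν i t) := by
  refine ((H.integrable_inner_velocity i ht hG).sub
    ((H.integrable_inner_self_velocity i ht hG).const_mul (a i))).congr (ae_of_all _ fun x => ?_)
  simp [H.velocity_eq_add_externalField i ht, inner_add_left, inner_smul_left]

/-- Decomposition of the work of the velocity into the symmetrized self-interaction and the work
of the external field. -/
lemma integral_inner_velocity (H : IsVortexFlow a ν u M) (i : Fin N) {t : ℝ} (ht : 0 ≤ t)
    {G : Plane → Plane} (hG : Integrable G (ν i t)) :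
    ∫ x, ⟪u t x, G x⟫ ∂ν i t =
      a i * (∫ z, (1 / 2 : ℝ) * ⟪biotSavart (z.1 - z.2), G z.1 - G z.2⟫ ∂((ν i t).prod (ν i t))) +
        ∫ x, ⟪externalField a ν i t x, G x⟫ ∂ν i t := by
  have := H.prob i t ht
  rw [← integral_inner_biotSavart_symmetrize H.nonneg (H.potential i t ht) hG,
    ← integral_const_mul, ← integral_add
      ((H.integrable_inner_self_velocity i ht hG).const_mul (a i))
      (H.integrable_inner_externalField i ht hG)]
  congr 1; funext x
  rw [H.velocity_eq_add_externalField i ht, inner_add_left, inner_smul_left]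
  rfl

lemma integral_velocity (H : IsVortexFlow a ν u M) (i : Fin N) {t : ℝ} (ht : 0 ≤ t) :
    ∫ x, u t x ∂ν i t = ∫ x, externalField a ν i t x ∂ν i t := by
  have := H.prob i t ht
  refine ext_inner_left ℝ fun w => ?_
  rw [← integral_inner (H.integrable_velocity i ht), ← integral_inner
    (H.integrable_externalField i ht)]
  simpa [real_inner_comm] using H.integral_inner_velocity i ht (G := fun _ => w)
    (integrable_const w)

lemma norm_integral_velocity_le (H : IsVortexFlow a ν u M) {i : Fin N} {t d : ℝ} (ht : 0 ≤ t)
    (hd : 0 < d) (hsep : IsSeparated ν i t d) :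
    ‖∫ x, u t x ∂ν i t‖ ≤ (∑ j, |a j|) * (2 * Real.pi * d)⁻¹ := by
  have := H.prob i t ht
  rw [H.integral_velocity i ht]
  have h := norm_integral_le_of_norm_le_const (μ := ν i t) (f := externalField a ν i t)
    (C := (∑ j, |a j|) * (2 * Real.pi * d)⁻¹) (by
      filter_upwards [hsep] with x hx
      exact H.norm_externalField_le ht hd hx)
  rwa [probReal_univ, mul_one] at h

/-- The derivative of the moment of inertia is controlled by the moment itself. -/
lemma abs_moment_deriv_le (H : IsVortexFlow a ν u M) {i : Fin N} {t d : ℝ} (ht : 0 ≤ t)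
    (hd : 0 < d) (hsep : IsSeparated ν i t d) :
    |2 * ∫ x, ⟪u t x, x - ∫ y, y ∂ν i t⟫ ∂ν i t| ≤
      4 * ((∑ j, |a j|) * (2 * Real.pi * d ^ 2)⁻¹) * ∫ x, ‖x - ∫ y, y ∂ν i t‖ ^ 2 ∂ν i t := by
  have := H.prob i t ht
  have hpi := Real.pi_pos
  set L := (∑ j, |a j|) * (2 * Real.pi * d ^ 2)⁻¹ with hL
  have hL0 : 0 ≤ L := by positivity
  set X := ∫ y, y ∂ν i t with hX
  set F := externalField a ν i t
  set m := ∫ x, ‖x - X‖ ∂ν i t with hm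
  set I := ∫ x, ‖x - X‖ ^ 2 ∂ν i t with hI
  have hc : ∀ {g : Plane → ℝ}, Continuous g → Integrable g (ν i t) := fun hg =>
    H.integrable_of_continuous i ht hg
  have hxX : Integrable (fun x => x - X) (ν i t) := H.integrable_of_continuous i ht (by fun_prop)
  have hF := H.integrable_externalField i ht
  have hmI : m ^ 2 ≤ I := by
    have h0 : 0 ≤ ∫ x, (‖x - X‖ - m) ^ 2 ∂ν i t := integral_nonneg fun x => sq_nonneg _
    have h1 : ∫ x, (‖x - X‖ - m) ^ 2 ∂ν i t = I - m ^ 2 := by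
      calc ∫ x, (‖x - X‖ - m) ^ 2 ∂ν i t
          = ∫ x, (‖x - X‖ ^ 2 - 2 * m * ‖x - X‖ + m ^ 2) ∂ν i t := by
            congr 1; funext x; ring
        _ = _ := by
            rw [integral_add (f := fun x => ‖x - X‖ ^ 2 - 2 * m * ‖x - X‖)
              (hc (by fun_prop)) (integrable_const _), integral_sub (hc (by fun_prop))
              (hc (by fun_prop)), integral_const_mul, ← hm]
            simp
            ring
    linarith
  have hmean : ∫ x, (x - X) ∂ν i t = 0 := by
    have hid : Integrable (fun x : Plane => x) (ν i t) :=
      H.integrable_of_continuous i ht continuous_id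
    rw [integral_sub hid (integrable_const X)]
    simp [hX]
  have hself : ∫ z, (1 / 2 : ℝ) * ⟪biotSavart (z.1 - z.2), (z.1 - X) - (z.2 - X)⟫
      ∂((ν i t).prod (ν i t)) = 0 := by
    simp [inner_biotSavart_self]
  have hdec : ∫ x, ⟪u t x, x - X⟫ ∂ν i t = ∫ x, ⟪F x - ∫ y, F y ∂ν i t, x - X⟫ ∂ν i t := by
    rw [H.integral_inner_velocity i ht hxX, hself, mul_zero, zero_add]
    simp_rw [inner_sub_left]
    rw [integral_sub (H.integrable_inner_externalField i ht hxX) (hxX.const_inner _),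
      integral_inner hxX, hmean, inner_zero_right, sub_zero]
  have hdev : ∀ᵐ x ∂ν i t, ‖F x - ∫ y, F y ∂ν i t‖ ≤ L * (‖x - X‖ + m) := by
    filter_upwards [hsep] with x hx
    have h1 : F x - ∫ y, F y ∂ν i t = ∫ y, (F x - F y) ∂ν i t := by
      rw [integral_sub (integrable_const _) hF]; simp; rfl
    rw [h1]
    calc ‖∫ y, (F x - F y) ∂ν i t‖ ≤ ∫ y, L * (‖x - X‖ + ‖y - X‖) ∂ν i t := by
          refine norm_integral_le_of_norm_le (hc (by fun_prop)) ?_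
          filter_upwards [hsep] with y hy
          refine (H.norm_externalField_sub_le ht hd hx hy).trans ?_
          gcongr
          have := norm_sub_le (x - X) (y - X)
          simpa using this
      _ = L * (‖x - X‖ + m) := by
          rw [integral_const_mul, integral_add (integrable_const _) (hc (by fun_prop))]
          simp [hm]
  have hbound : ‖∫ x, ⟪F x - ∫ y, F y ∂ν i t, x - X⟫ ∂ν i t‖ ≤ L * (I + m * m) := by
    calc ‖∫ x, ⟪F x - ∫ y, F y ∂ν i t, x - X⟫ ∂ν i t‖
        ≤ ∫ x, L * (‖x - X‖ ^ 2 + m * ‖x - X‖) ∂ν i t := by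
          refine norm_integral_le_of_norm_le (hc (by fun_prop)) ?_
          filter_upwards [hdev] with x hx
          refine (norm_inner_le_norm _ _).trans ?_
          calc ‖F x - ∫ y, F y ∂ν i t‖ * ‖x - X‖ ≤ L * (‖x - X‖ + m) * ‖x - X‖ := by gcongr
            _ = _ := by ring
      _ = _ := by
          rw [integral_const_mul, integral_add (hc (by fun_prop)) (hc (by fun_prop)),
            integral_const_mul]
  rw [hdec, abs_mul, abs_two]
  rw [Real.norm_eq_abs] at hbound
  nlinarith [mul_le_mul_of_nonneg_left hmI hL0]

lemma moment_le (H : IsVortexFlow a ν u M) {i : Fin N} {T d : ℝ} (hd : 0 < d)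
    (hsep : ∀ s ∈ Set.Icc 0 T, IsSeparated ν i s d) {t : ℝ} (ht : t ∈ Set.Icc 0 T) :
    ∫ x, ‖x - ∫ y, y ∂ν i t‖ ^ 2 ∂ν i t ≤ (∫ x, ‖x - ∫ y, y ∂ν i 0‖ ^ 2 ∂ν i 0) *
      Real.exp (4 * ((∑ j, |a j|) * (2 * Real.pi * d ^ 2)⁻¹) * t) := by
  have hnn : ∀ s, 0 ≤ ∫ x, ‖x - ∫ y, y ∂ν i s‖ ^ 2 ∂ν i s := fun s =>
    integral_nonneg fun x => by positivity
  have h := norm_le_gronwallBound_of_norm_deriv_right_le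
    (f := fun s => ∫ x, ‖x - ∫ y, y ∂ν i s‖ ^ 2 ∂ν i s)
    (f' := fun s => 2 * ∫ x, ⟪u s x, x - ∫ y, y ∂ν i s⟫ ∂ν i s)
    (δ := ∫ x, ‖x - ∫ y, y ∂ν i 0‖ ^ 2 ∂ν i 0)
    (K := 4 * ((∑ j, |a j|) * (2 * Real.pi * d ^ 2)⁻¹)) (ε := 0) (a := 0) (b := T)
    (fun s hs => (H.hasDerivWithinAt_moment i hs).continuousWithinAt)
    (fun s hs => (H.hasDerivWithinAt_moment i ⟨hs.1, hs.2.le⟩).mono_of_mem_nhdsWithin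
      (Icc_mem_nhdsGE_of_mem hs))
    (Real.norm_of_nonneg (hnn 0)).le
    (fun s hs => by
      rw [Real.norm_of_nonneg (hnn s), add_zero]
      exact H.abs_moment_deriv_le hs.1 hd (hsep s ⟨hs.1, hs.2.le⟩)) t ht
  rw [gronwallBound_ε0, sub_zero] at h
  exact (le_abs_self _).trans h

/-- The center minimizes the second moment. -/
lemma moment_le_of_point (H : IsVortexFlow a ν u M) (i : Fin N) {t : ℝ} (ht : 0 ≤ t) (Y : Plane) :
    ∫ x, ‖x - ∫ y, y ∂ν i t‖ ^ 2 ∂ν i t ≤ ∫ x, ‖x - Y‖ ^ 2 ∂ν i t := by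
  have := H.prob i t ht
  set X := ∫ y, y ∂ν i t with hX
  have hid : Integrable (fun x : Plane => x) (ν i t) :=
    H.integrable_of_continuous i ht continuous_id
  have hc : ∀ {g : Plane → ℝ}, Continuous g → Integrable g (ν i t) := fun hg =>
    H.integrable_of_continuous i ht hg
  have hxX : Integrable (fun x => x - X) (ν i t) := H.integrable_of_continuous i ht (by fun_prop)
  have hmean : ∫ x, (x - X) ∂ν i t = 0 := by
    rw [integral_sub hid (integrable_const X)]
    simp [hX]
  have h : ∫ x, ‖x - Y‖ ^ 2 ∂ν i t = ∫ x, ‖x - X‖ ^ 2 ∂ν i t + ‖X - Y‖ ^ 2 := by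
    calc ∫ x, ‖x - Y‖ ^ 2 ∂ν i t
        = ∫ x, (‖x - X‖ ^ 2 + 2 * ⟪X - Y, x - X⟫ + ‖X - Y‖ ^ 2) ∂ν i t := by
          congr 1; funext x
          rw [← sub_add_sub_cancel x X Y, norm_add_sq_real, real_inner_comm]
      _ = _ := by
          rw [integral_add (f := fun x => ‖x - X‖ ^ 2 + 2 * ⟪X - Y, x - X⟫)
            (hc (by fun_prop)) (integrable_const _), integral_add (hc (by fun_prop))
            (hc (by fun_prop)), integral_const_mul, integral_inner hxX, hmean]
          simp
  rw [h]
  linarith [sq_nonneg ‖X - Y‖]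

end IsVortexFlow

namespace IsCutoff

variable {C₁ ρ h : ℝ} {ψ : Plane → ℝ}

lemma contDiff_two (hψ : IsCutoff C₁ ρ h ψ) : ContDiff ℝ 2 ψ :=
  contDiff_infty.1 hψ.1 2

lemma norm_fderiv_le (hψ : IsCutoff C₁ ρ h ψ) (x : Plane) : ‖fderiv ℝ ψ x‖ ≤ C₁ / h :=
  norm_gradient_eq ψ x ▸ hψ.2.2.2.2.2.1 x

lemma norm_fderiv_sub_le (hψ : IsCutoff C₁ ρ h ψ) (x y : Plane) :
    ‖fderiv ℝ ψ x - fderiv ℝ ψ y‖ ≤ C₁ / h ^ 2 * ‖x - y‖ := by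
  have hd : Differentiable ℝ (fderiv ℝ ψ) :=
    (hψ.contDiff_two.fderiv_right (m := 1) (by norm_num)).differentiable one_ne_zero
  refine Convex.norm_image_sub_le_of_norm_fderiv_le (s := Set.univ) (fun z _ => hd z)
    (fun z _ => ?_) convex_univ (Set.mem_univ y) (Set.mem_univ x)
  have h2 := hψ.2.2.2.2.2.2 z
  rwa [← norm_iteratedFDeriv_fderiv (n := 1), norm_iteratedFDeriv_one] at h2

lemma gradient_eq_zero (hψ : IsCutoff C₁ ρ h ψ) {x : Plane} (hx : ‖x‖ < ρ) :
    gradient ψ x = 0 := by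
  have : ψ =ᶠ[nhds x] fun _ => (1 : ℝ) := by
    filter_upwards [(isOpen_lt continuous_norm continuous_const).mem_nhds hx] with y hy
    exact hψ.2.2.2.1 y hy
  rw [gradient, this.fderiv_eq]
  simp

lemma nonneg_one_sub (hψ : IsCutoff C₁ ρ h ψ) (x : Plane) : 0 ≤ 1 - ψ x :=
  sub_nonneg.2 (hψ.2.2.1 x).2

variable {ψ' : Plane → ℝ}

lemma one_sub_eq_one (hψ' : IsCutoff C₁ (ρ - h) h ψ') {x : Plane} (hx : ρ ≤ ‖x‖) :
    1 - ψ' x = 1 := by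
  rw [hψ'.2.2.2.2.1 x (by linarith), sub_zero]

lemma norm_gradient_le_mul (hC₁ : 0 ≤ C₁) (hh : 0 < h) (hψ : IsCutoff C₁ ρ h ψ)
    (hψ' : IsCutoff C₁ (ρ - h) h ψ') (x : Plane) :
    ‖gradient ψ x‖ ≤ C₁ / h * (1 - ψ' x) := by
  rcases lt_or_ge ‖x‖ ρ with hx | hx
  · rw [hψ.gradient_eq_zero hx, norm_zero]
    have := hψ'.nonneg_one_sub x
    positivity
  · rw [hψ'.one_sub_eq_one hx, mul_one]
    exact hψ.2.2.2.2.2.1 x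

lemma norm_biotSavart_mul_norm_gradient_sub_le_of_le {R : ℝ} (hR : 0 < R) (hRρ : R ≤ ρ)
    (hC₁ : 0 ≤ C₁) (hh : 0 < h) (hψ : IsCutoff C₁ ρ h ψ) {x y : Plane} (hx : ρ ≤ ‖x‖) :
    ‖biotSavart (x - y)‖ * ‖gradient ψ x - gradient ψ y‖ ≤
      C₁ / (2 * Real.pi * h ^ 2) * (4 * ‖y‖ ^ 2 / R ^ 2) + C₁ / (Real.pi * R * h) := by
  have hpi := Real.pi_pos
  rcases lt_or_ge ‖y‖ (R / 2) with hy | hy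
  · have hxy : R / 2 ≤ ‖x - y‖ := by linarith [norm_sub_norm_le x y]
    rw [hψ.gradient_eq_zero (x := y) (by linarith), sub_zero]
    calc ‖biotSavart (x - y)‖ * ‖gradient ψ x‖
        ≤ (2 * Real.pi * (R / 2))⁻¹ * (C₁ / h) := by
          gcongr
          · exact norm_biotSavart_le (by positivity) hxy
          · exact hψ.2.2.2.2.2.1 x
      _ = C₁ / (Real.pi * R * h) := by field_simp
      _ ≤ _ := le_add_of_nonneg_left (by positivity)
  · have hq : 1 ≤ 4 * ‖y‖ ^ 2 / R ^ 2 := by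
      rw [one_le_div (by positivity)]
      nlinarith
    have h1 : ‖x - y‖⁻¹ * ‖x - y‖ ≤ 1 := inv_mul_le_one
    calc ‖biotSavart (x - y)‖ * ‖gradient ψ x - gradient ψ y‖
        ≤ ((2 * Real.pi)⁻¹ * ‖x - y‖⁻¹) * (C₁ / h ^ 2 * ‖x - y‖) := by
          rw [norm_biotSavart, norm_gradient_sub]
          gcongr
          exact hψ.norm_fderiv_sub_le x y
      _ = C₁ / (2 * Real.pi * h ^ 2) * (‖x - y‖⁻¹ * ‖x - y‖) := by field_simp
      _ ≤ C₁ / (2 * Real.pi * h ^ 2) * (4 * ‖y‖ ^ 2 / R ^ 2) := by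
          gcongr
          exact h1.trans hq
      _ ≤ _ := le_add_of_nonneg_right (by positivity)

/-- The symmetrized kernel tested against the gradient of a cutoff is controlled by the mass
outside the cutoff and the second moment. -/
lemma norm_biotSavart_mul_norm_gradient_sub_le {R : ℝ} (hR : 0 < R) (hRρ : R ≤ ρ)
    (hC₁ : 0 ≤ C₁) (hh : 0 < h) (hψ : IsCutoff C₁ ρ h ψ) (hψ' : IsCutoff C₁ (ρ - h) h ψ')
    (x y : Plane) :
    ‖biotSavart (x - y)‖ * ‖gradient ψ x - gradient ψ y‖ ≤
      ((1 - ψ' x) * (C₁ / (2 * Real.pi * h ^ 2) * (4 * ‖y‖ ^ 2 / R ^ 2) + C₁ / (Real.pi * R * h)) +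
        (C₁ / (2 * Real.pi * h ^ 2) * (4 * ‖x‖ ^ 2 / R ^ 2) + C₁ / (Real.pi * R * h)) *
          (1 - ψ' y)) := by
  have hpi := Real.pi_pos
  have hx0 := hψ'.nonneg_one_sub x
  have hy0 := hψ'.nonneg_one_sub y
  rcases le_or_gt ρ ‖x‖ with hx | hx
  · refine (hψ.norm_biotSavart_mul_norm_gradient_sub_le_of_le hR hRρ hC₁ hh hx).trans ?_
    rw [hψ'.one_sub_eq_one hx, one_mul]
    exact le_add_of_nonneg_right (by positivity)
  rcases le_or_gt ρ ‖y‖ with hy | hy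
  · rw [← neg_sub y x, biotSavart_neg, norm_neg, ← norm_neg (gradient ψ x - _), neg_sub]
    refine (hψ.norm_biotSavart_mul_norm_gradient_sub_le_of_le hR hRρ hC₁ hh hy).trans ?_
    rw [hψ'.one_sub_eq_one hy, mul_one]
    exact le_add_of_nonneg_left (by positivity)
  · rw [hψ.gradient_eq_zero hx, hψ.gradient_eq_zero hy, sub_zero, norm_zero, mul_zero]
    positivity

end IsCutoff

namespace IsVortexFlow

variable {N : ℕ} {a : Fin N → ℝ} {ν : Fin N → ℝ → Measure Plane} {u : ℝ → Plane → Plane} {M : ℝ}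

lemma abs_integral_self_interaction_le (H : IsVortexFlow a ν u M) (i : Fin N) {t : ℝ}
    (ht : 0 ≤ t) {C₁ ρ h R : ℝ} (hR : 0 < R) (hRρ : R ≤ ρ) (hC₁ : 0 ≤ C₁) (hh : 0 < h)
    {ψ ψ' : Plane → ℝ} (hψ : IsCutoff C₁ ρ h ψ) (hψ' : IsCutoff C₁ (ρ - h) h ψ') (X : Plane) :
    |∫ z, (1 / 2 : ℝ) * ⟪biotSavart (z.1 - z.2), gradient ψ (z.1 - X) - gradient ψ (z.2 - X)⟫
      ∂((ν i t).prod (ν i t))| ≤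
      (2 * C₁ / (Real.pi * R ^ 2 * h ^ 2) * (∫ x, ‖x - X‖ ^ 2 ∂ν i t) + C₁ / (Real.pi * R * h)) *
        ∫ x, (1 - ψ' (x - X)) ∂ν i t := by
  have := H.prob i t ht
  have hpi := Real.pi_pos
  have hψc : Continuous ψ' := hψ'.1.continuous
  have hc : ∀ {g : Plane → ℝ}, Continuous g → Integrable g (ν i t) := fun hg =>
    H.integrable_of_continuous i ht hg
  set e : Plane → ℝ := fun x => 1 - ψ' (x - X) with he
  set q : Plane → ℝ := fun x => C₁ / (2 * Real.pi * h ^ 2) * (4 * ‖x - X‖ ^ 2 / R ^ 2) +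
    C₁ / (Real.pi * R * h) with hq
  have hei : Integrable e (ν i t) := hc (by fun_prop)
  have hqi : Integrable q (ν i t) := hc (by fun_prop)
  have hqint : ∫ x, q x ∂ν i t =
      2 * C₁ / (Real.pi * R ^ 2 * h ^ 2) * (∫ x, ‖x - X‖ ^ 2 ∂ν i t) + C₁ / (Real.pi * R * h) := by
    calc ∫ x, q x ∂ν i t = ∫ x, (2 * C₁ / (Real.pi * R ^ 2 * h ^ 2) * ‖x - X‖ ^ 2 +
          C₁ / (Real.pi * R * h)) ∂ν i t := by
          congr 1; funext x; simp only [hq]; field_simp; ring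
      _ = _ := by
          rw [integral_add (hc (by fun_prop)) (integrable_const _), integral_const_mul]
          simp
  calc _ ≤ ∫ z, (1 / 2 : ℝ) * (e z.1 * q z.2 + q z.1 * e z.2) ∂((ν i t).prod (ν i t)) := by
        rw [← Real.norm_eq_abs]
        refine norm_integral_le_of_norm_le
          (((hei.mul_prod hqi).add (hqi.mul_prod hei)).const_mul _) (ae_of_all _ fun z => ?_)
        rw [norm_mul, Real.norm_of_nonneg (by norm_num : (0 : ℝ) ≤ 1 / 2)]
        gcongr
        refine (norm_inner_le_norm _ _).trans ?_
        have := IsCutoff.norm_biotSavart_mul_norm_gradient_sub_le hR hRρ hC₁ hh hψ hψ'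
          (z.1 - X) (z.2 - X)
        rwa [sub_sub_sub_cancel_right] at this
    _ = (∫ x, q x ∂ν i t) * ∫ x, e x ∂ν i t := by
        rw [integral_const_mul, integral_add (hei.mul_prod hqi) (hqi.mul_prod hei),
          integral_prod_mul, integral_prod_mul]
        ring
    _ = _ := by rw [hqint]

/-- The flux of mass through a cutoff moving with the center is controlled by the mass outside
a slightly smaller cutoff. -/
lemma abs_flux_le (H : IsVortexFlow a ν u M) {i : Fin N} {t d : ℝ} (ht : 0 ≤ t) (hd : 0 < d)
    (hsep : IsSeparated ν i t d) {C₁ ρ h R : ℝ} (hR : 0 < R) (hRρ : R ≤ ρ) (hC₁ : 0 ≤ C₁)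
    (hh : 0 < h) {ψ ψ' : Plane → ℝ} (hψ : IsCutoff C₁ ρ h ψ) (hψ' : IsCutoff C₁ (ρ - h) h ψ')
    (X : Plane) :
    |∫ x, ⟪u t x - ∫ y, u t y ∂ν i t, gradient ψ (x - X)⟫ ∂ν i t| ≤
      (∑ j, |a j|) * (2 * C₁ / (Real.pi * R ^ 2 * h ^ 2) * (∫ x, ‖x - X‖ ^ 2 ∂ν i t) +
        C₁ / (Real.pi * R * h) + C₁ / (Real.pi * d * h)) * ∫ x, (1 - ψ' (x - X)) ∂ν i t := by
  have := H.prob i t ht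
  have hpi := Real.pi_pos
  have hψc : Continuous ψ' := hψ'.1.continuous
  set S := ∑ j, |a j| with hS
  have hS0 : 0 ≤ S := Finset.sum_nonneg fun j _ => abs_nonneg _
  have hai : |a i| ≤ S := Finset.single_le_sum (f := fun j => |a j|)
    (fun j _ => abs_nonneg _) (Finset.mem_univ i)
  set V := ∫ y, u t y ∂ν i t
  set G : Plane → Plane := fun x => gradient ψ (x - X)
  set m := ∫ x, (1 - ψ' (x - X)) ∂ν i t
  have hm0 : 0 ≤ m := integral_nonneg fun x => hψ'.nonneg_one_sub _
  have hI0 : 0 ≤ ∫ x, ‖x - X‖ ^ 2 ∂ν i t := integral_nonneg fun x => by positivity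
  have hG : Integrable G (ν i t) := H.integrable_of_continuous i ht
    ((continuous_gradient (hψ.contDiff_two.of_le (by norm_num))).comp (by fun_prop))
  have hdec : ∫ x, ⟪u t x - V, G x⟫ ∂ν i t =
      a i * (∫ z, (1 / 2 : ℝ) * ⟪biotSavart (z.1 - z.2), G z.1 - G z.2⟫
        ∂((ν i t).prod (ν i t))) + ∫ x, ⟪externalField a ν i t x - V, G x⟫ ∂ν i t := by
    simp_rw [inner_sub_left]
    rw [integral_sub (H.integrable_inner_velocity i ht hG) (hG.const_inner _),
      integral_sub (H.integrable_inner_externalField i ht hG) (hG.const_inner _),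
      H.integral_inner_velocity i ht hG]
    ring
  have hext : |∫ x, ⟪externalField a ν i t x - V, G x⟫ ∂ν i t| ≤
      S * (C₁ / (Real.pi * d * h)) * m := by
    rw [← integral_const_mul, ← Real.norm_eq_abs]
    refine norm_integral_le_of_norm_le
      (H.integrable_of_continuous i ht (by fun_prop)) ?_
    filter_upwards [hsep] with x hx
    have h1 := H.norm_externalField_le ht hd hx
    have h2 := H.norm_integral_velocity_le ht hd hsep
    calc ‖⟪externalField a ν i t x - V, G x⟫‖
        ≤ ‖externalField a ν i t x - V‖ * ‖G x‖ := norm_inner_le_norm _ _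
      _ ≤ (S * (2 * Real.pi * d)⁻¹ + S * (2 * Real.pi * d)⁻¹) *
            (C₁ / h * (1 - ψ' (x - X))) := by
          gcongr
          · exact (norm_sub_le _ _).trans (add_le_add h1 h2)
          · exact IsCutoff.norm_gradient_le_mul hC₁ hh hψ hψ' _
      _ = _ := by field_simp; ring
  have hself := H.abs_integral_self_interaction_le i ht hR hRρ hC₁ hh hψ hψ' X
  rw [hdec]
  refine (abs_add_le _ _).trans ?_
  rw [abs_mul]
  calc _ ≤ S * ((2 * C₁ / (Real.pi * R ^ 2 * h ^ 2) * (∫ x, ‖x - X‖ ^ 2 ∂ν i t) +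
          C₁ / (Real.pi * R * h)) * m) + S * (C₁ / (Real.pi * d * h)) * m := by
        gcongr
    _ = _ := by ring

/-- Growth of the mass outside a cutoff moving with the center. -/
lemma outer_mass_le (H : IsVortexFlow a ν u M) {i : Fin N} {T T₀ d ε : ℝ} (hT : T ≤ T₀)
    (hd : 0 < d) (hsep : ∀ s ∈ Set.Icc 0 T, IsSeparated ν i s d)
    (hε : ∫ x, ‖x - ∫ y, y ∂ν i 0‖ ^ 2 ∂ν i 0 ≤ ε ^ 2) {C₁ ρ h R : ℝ} (hR : 0 < R)
    (hRρ : R ≤ ρ) (hC₁ : 0 ≤ C₁) (hh : 0 < h) {ψ ψ' : Plane → ℝ} (hψ : IsCutoff C₁ ρ h ψ)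
    (hψ' : IsCutoff C₁ (ρ - h) h ψ') {t : ℝ} (ht : t ∈ Set.Icc 0 T) :
    ∫ x, (1 - ψ (x - ∫ y, y ∂ν i t)) ∂ν i t ≤ ∫ x, (1 - ψ (x - ∫ y, y ∂ν i 0)) ∂ν i 0 +
      (∑ j, |a j|) * C₁ * (2 * Real.exp (4 * ((∑ j, |a j|) * (2 * Real.pi * d ^ 2)⁻¹) * T₀) /
        (Real.pi * R ^ 2) + 1 / (Real.pi * R) + 1 / (Real.pi * d)) * (ε ^ 2 / h ^ 2 + 1 / h) *
      ∫ s in (0 : ℝ)..t, ∫ x, (1 - ψ' (x - ∫ y, y ∂ν i s)) ∂ν i s := by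
  have hpi := Real.pi_pos
  set S := ∑ j, |a j| with hS
  have hS0 : 0 ≤ S := Finset.sum_nonneg fun j _ => abs_nonneg _
  set E := Real.exp (4 * (S * (2 * Real.pi * d ^ 2)⁻¹) * T₀) with hE
  set X : ℝ → Plane := fun s => ∫ y, y ∂ν i s with hX
  set C := S * C₁ * (2 * E / (Real.pi * R ^ 2) + 1 / (Real.pi * R) + 1 / (Real.pi * d)) with hC
  have hderiv : ∀ {C₂ ρ' h' : ℝ} {χ : Plane → ℝ}, 0 ≤ C₂ → IsCutoff C₂ ρ' h' χ → ∀ s, 0 ≤ s →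
      HasDerivWithinAt (fun s => ∫ x, (1 - χ (x - X s)) ∂ν i s)
        (-∫ x, ⟪u s x - ∫ y, u s y ∂ν i s, gradient χ (x - X s)⟫ ∂ν i s) (Set.Ici 0) s := by
    intro C₂ ρ' h' χ hC₂ hχ s hs
    refine (((H.hasDerivWithinAt_integral_translate i hχ.contDiff_two hχ.norm_fderiv_le
      (by positivity) hχ.norm_fderiv_sub_le hs (H.hasDerivWithinAt_center i hs)).const_sub
      1).congr_of_mem (fun r hr => ?_) hs)
    have := H.prob i r hr
    have hχc : Continuous χ := hχ.1.continuous
    rw [integral_sub (integrable_const _) (H.integrable_of_continuous i hr (by fun_prop))]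
    simp [hX]
  have hmass : ContinuousOn (fun s => ∫ x, (1 - ψ' (x - X s)) ∂ν i s) (Set.Icc 0 t) := fun s hs =>
    ((hderiv hC₁ hψ' s hs.1).continuousWithinAt).mono Set.Icc_subset_Ici_self
  have key := intervalIntegral.sub_le_integral_of_hasDeriv_right_of_le ht.1
    (g := fun s => ∫ x, (1 - ψ (x - X s)) ∂ν i s)
    (φ := fun s => C * (ε ^ 2 / h ^ 2 + 1 / h) * ∫ x, (1 - ψ' (x - X s)) ∂ν i s)
    (fun s hs => ((hderiv hC₁ hψ s hs.1).continuousWithinAt).mono Set.Icc_subset_Ici_self)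
    (fun s hs => (hderiv hC₁ hψ s hs.1.le).mono (Set.Ioi_subset_Ici hs.1.le))
    ((hmass.const_smul (C * (ε ^ 2 / h ^ 2 + 1 / h))).integrableOn_compact isCompact_Icc)
    (fun s hs => by
      have hsT : s ∈ Set.Icc 0 T := ⟨hs.1.le, hs.2.le.trans ht.2⟩
      have hm0 : 0 ≤ ∫ x, (1 - ψ' (x - X s)) ∂ν i s :=
        integral_nonneg fun x => hψ'.nonneg_one_sub _
      have hI : ∫ x, ‖x - X s‖ ^ 2 ∂ν i s ≤ ε ^ 2 * E := by
        refine (H.moment_le hd hsep hsT).trans ?_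
        rw [hE]
        gcongr
        exact hsT.2.trans hT
      refine (neg_le_abs _).trans
        ((H.abs_flux_le hsT.1 hd (hsep s hsT) hR hRρ hC₁ hh hψ hψ' (X s)).trans ?_)
      refine mul_le_mul_of_nonneg_right ?_ hm0
      calc S * (2 * C₁ / (Real.pi * R ^ 2 * h ^ 2) * (∫ x, ‖x - X s‖ ^ 2 ∂ν i s) +
            C₁ / (Real.pi * R * h) + C₁ / (Real.pi * d * h))
          ≤ S * (2 * C₁ / (Real.pi * R ^ 2 * h ^ 2) * (ε ^ 2 * E) +
            C₁ / (Real.pi * R * h) + C₁ / (Real.pi * d * h)) := by gcongr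
        _ = S * C₁ * (2 * E / (Real.pi * R ^ 2) * (ε ^ 2 / h ^ 2) +
            (1 / (Real.pi * R) + 1 / (Real.pi * d)) * (1 / h)) := by field_simp; ring
        _ ≤ S * C₁ * (2 * E / (Real.pi * R ^ 2) * (ε ^ 2 / h ^ 2 + 1 / h) +
            (1 / (Real.pi * R) + 1 / (Real.pi * d)) * (ε ^ 2 / h ^ 2 + 1 / h)) := by
          gcongr
          · exact le_add_of_nonneg_right (by positivity)
          · exact le_add_of_nonneg_left (by positivity)
        _ = C * (ε ^ 2 / h ^ 2 + 1 / h) := by rw [hC]; ring)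
  rw [intervalIntegral.integral_const_mul] at key
  linarith

end IsVortexFlow

/-- The probability measure with density `f / c`, for a density `f` of total mass `c`. -/
noncomputable def normalizedMeasure (c : ℝ) (f : Plane → ℝ) : Measure Plane :=
  volume.withDensity fun x => ENNReal.ofReal (c⁻¹ * f x)

section NormalizedMeasure

variable {c : ℝ} {f : Plane → ℝ}

lemma inv_mul_nonneg_of_mul_nonneg {c y : ℝ} (h : 0 ≤ c * y) : 0 ≤ c⁻¹ * y := by
  have h' : c⁻¹ * y = c⁻¹ ^ 2 * (c * y) := by
    rcases eq_or_ne c 0 with rfl | hc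
    · simp
    · field_simp
  rw [h']
  positivity

lemma integral_normalizedMeasure {F : Type*} [NormedAddCommGroup F] [NormedSpace ℝ F]
    (hf : Measurable f) (hpos : ∀ x, 0 ≤ c * f x) (g : Plane → F) :
    ∫ x, g x ∂normalizedMeasure c f = c⁻¹ • ∫ x, f x • g x := by
  rw [normalizedMeasure, integral_withDensity_eq_integral_toReal_smul (by fun_prop)
    (ae_of_all _ fun x => ENNReal.ofReal_lt_top), ← integral_smul]
  congr 1; funext x
  rw [ENNReal.toReal_ofReal (inv_mul_nonneg_of_mul_nonneg (hpos x)), smul_smul]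

lemma lintegral_normalized_density (hc : c ≠ 0) (hpos : ∀ x, 0 ≤ c * f x)
    (hint : ∫ x, f x = c) : ∫⁻ x, ENNReal.ofReal (c⁻¹ * f x) = 1 := by
  have hfi : Integrable f := by
    by_contra h
    exact hc (by rw [← hint, integral_undef h])
  rw [← ofReal_integral_eq_lintegral_ofReal (hfi.const_mul _)
    (ae_of_all _ fun x => inv_mul_nonneg_of_mul_nonneg (hpos x)), integral_const_mul, hint,
    inv_mul_cancel₀ hc, ENNReal.ofReal_one]

lemma isProbabilityMeasure_normalizedMeasure (hc : c ≠ 0) (hpos : ∀ x, 0 ≤ c * f x)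
    (hint : ∫ x, f x = c) : IsProbabilityMeasure (normalizedMeasure c f) := by
  refine ⟨?_⟩
  rw [normalizedMeasure, withDensity_apply _ MeasurableSet.univ, Measure.restrict_univ,
    lintegral_normalized_density hc hpos hint]

lemma ae_normalizedMeasure_mem_support (hf : Measurable f) :
    ∀ᵐ x ∂normalizedMeasure c f, x ∈ Function.support f := by
  rw [normalizedMeasure, ae_withDensity_iff (by fun_prop)]
  refine ae_of_all _ fun x hx hfx => hx ?_
  simp [hfx]

lemma lintegral_normalizedMeasure_biotSavart_le {p : ℝ} (hp : 0 < p) {k : ℝ≥0∞}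
    (hk : ∀ f : Plane → ℝ≥0∞, Measurable f → ∀ x,
      ∫⁻ y, f y * ‖biotSavart (x - y)‖ₑ ≤ (∫⁻ y, f y) + (∫⁻ y, f y ^ p) ^ (1 / p) * k)
    (hc : c ≠ 0) (hf : Measurable f) (hpos : ∀ x, 0 ≤ c * f x) (hint : ∫ x, f x = c) (x : Plane) :
    ∫⁻ y, ‖biotSavart (x - y)‖ₑ ∂normalizedMeasure c f ≤
      1 + ‖c⁻¹‖ₑ * eLpNorm f (ENNReal.ofReal p) volume * k := by
  have hm : Measurable fun y => ‖biotSavart (x - y)‖ₑ :=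
    (measurable_biotSavart.comp (by fun_prop)).enorm
  rw [normalizedMeasure, lintegral_withDensity_eq_lintegral_mul volume (by fun_prop) hm]
  refine (hk _ (by fun_prop) x).trans (le_of_eq ?_)
  rw [lintegral_normalized_density hc hpos hint]
  congr 2
  rw [← eLpNorm_const_smul, eLpNorm_eq_lintegral_rpow_enorm_toReal (by simpa using hp)
    ENNReal.ofReal_ne_top, ENNReal.toReal_ofReal hp.le]
  congr 1
  refine lintegral_congr fun y => ?_
  rw [Pi.smul_apply, smul_eq_mul, Real.enorm_of_nonneg (inv_mul_nonneg_of_mul_nonneg (hpos y))]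

end NormalizedMeasure

/-- The normalized vorticities of a solution of the transport equations form a vortex flow. -/
lemma exists_isVortexFlow {N : ℕ} {a : Fin N → ℝ} (ha : ∀ i, a i ≠ 0) {p : ℝ} (hp : 2 < p)
    {ω : Fin N → ℝ → Plane → ℝ} {u : ℝ → Plane → Plane}
    (hmeas : ∀ i, ∀ t : ℝ, 0 ≤ t → Measurable (ω i t))
    (hsupp : ∀ i, ∀ t : ℝ, 0 ≤ t → HasCompactSupport (ω i t))
    (hpos : ∀ i, ∀ t : ℝ, 0 ≤ t → ∀ x, 0 ≤ a i * ω i t x)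
    (hint : ∀ i, ∀ t : ℝ, 0 ≤ t → (∫ x, ω i t x) = a i)
    (hcons : ∀ i, ∀ t : ℝ, 0 ≤ t →
      eLpNorm (ω i t) (ENNReal.ofReal p) volume = eLpNorm (ω i 0) (ENNReal.ofReal p) volume)
    (hfin : ∀ i, eLpNorm (ω i 0) (ENNReal.ofReal p) volume < ⊤)
    (hu : ∀ t x, u t x = ∫ y, (∑ j, ω j t y) • biotSavart (x - y))
    (hweak : ∀ i, ∀ φ : Plane → ℝ, ContDiff ℝ 1 φ → (∃ M, ∀ x, ‖gradient φ x‖ ≤ M) →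
      ∀ t : ℝ, 0 ≤ t → HasDerivWithinAt (fun s => ∫ x, ω i s x * φ x)
        (∫ x, ω i t x * ⟪u t x, gradient φ x⟫) (Set.Ici 0) t) :
    ∃ M, IsVortexFlow a (fun i t => normalizedMeasure (a i) (ω i t)) u M := by
  obtain ⟨k, hk, hkle⟩ := exists_lintegral_biotSavart_mul_le hp
  set m : ℝ≥0∞ := ∑ j, (1 + ‖(a j)⁻¹‖ₑ * eLpNorm (ω j 0) (ENNReal.ofReal p) volume * k)
  have hm : m ≠ ⊤ := by
    refine ENNReal.sum_ne_top.2 fun j _ => ENNReal.add_ne_top.2 ⟨ENNReal.one_ne_top, ?_⟩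
    exact ENNReal.mul_ne_top (ENNReal.mul_ne_top enorm_ne_top (hfin j).ne) hk
  have hpot : ∀ i t, 0 ≤ t → ∀ x,
      ∫⁻ y, ‖biotSavart (x - y)‖ₑ ∂normalizedMeasure (a i) (ω i t) ≤ ENNReal.ofReal m.toReal := by
    intro i t ht x
    rw [ENNReal.ofReal_toReal hm]
    refine (lintegral_normalizedMeasure_biotSavart_le (by linarith) hkle (ha i) (hmeas i t ht)
      (hpos i t ht) (hint i t ht) x).trans ?_
    rw [hcons i t ht]
    exact Finset.single_le_sum (f := fun j =>
      1 + ‖(a j)⁻¹‖ₑ * eLpNorm (ω j 0) (ENNReal.ofReal p) volume * k)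
      (fun j _ => zero_le) (Finset.mem_univ i)
  refine ⟨m.toReal, ENNReal.toReal_nonneg, fun i t ht =>
    isProbabilityMeasure_normalizedMeasure (ha i) (hpos i t ht) (hint i t ht), fun i t ht => ?_,
    hpot, fun t ht x => ?_, fun i φ hφ hB t ht => ?_⟩
  · obtain ⟨r, hr⟩ := (hsupp i t ht).isBounded.exists_norm_le
    refine ⟨r, ?_⟩
    filter_upwards [ae_normalizedMeasure_mem_support (hmeas i t ht)] with x hx
    exact hr x (subset_tsupport _ hx)
  · have hj : ∀ j, Integrable fun y => ω j t y • biotSavart (x - y) := by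
      intro j
      have h := integrable_biotSavart_sub (hpot j t ht) x
      have := hmeas j t ht
      rw [normalizedMeasure, integrable_withDensity_iff_integrable_smul' (by fun_prop)
        (ae_of_all _ fun x => ENNReal.ofReal_lt_top)] at h
      refine (h.smul (a j)).congr (ae_of_all _ fun y => ?_)
      simp only [Pi.smul_apply]
      rw [ENNReal.toReal_ofReal (inv_mul_nonneg_of_mul_nonneg (hpos j t ht y)), smul_smul,
        mul_inv_cancel_left₀ (ha j)]
    rw [hu]
    simp_rw [Finset.sum_smul]
    rw [integral_finsetSum _ fun j _ => hj j]
    refine Finset.sum_congr rfl fun j _ => ?_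
    rw [integral_normalizedMeasure (hmeas j t ht) (hpos j t ht), smul_inv_smul₀ (ha j)]
  · rw [integral_normalizedMeasure (hmeas i t ht) (hpos i t ht)]
    refine ((hweak i φ hφ hB t ht).const_smul (a i)⁻¹).congr_of_mem (fun s hs => ?_) ht
    exact integral_normalizedMeasure (hmeas i s hs) (hpos i s hs) φ

theorem stmt9 (N : ℕ) (hN : 1 ≤ N) (a : Fin N → ℝ) (ha : ∀ i, a i ≠ 0)
    (δ R C₁ T₀ : ℝ) (hδ : 0 < δ) (hR : 0 < R) (hC₁ : 0 < C₁) (hT₀ : 0 < T₀) :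
    ∃ C > (0:ℝ),
      ∀ p γ Λ : ℝ, 2 < p → 0 < γ → 0 < Λ →
      ∀ ε : ℝ, 0 < ε →
      ∀ (ωi : Fin N → ℝ → EuclideanSpace ℝ (Fin 2) → ℝ)
        (u : ℝ → EuclideanSpace ℝ (Fin 2) → EuclideanSpace ℝ (Fin 2))
        (X : Fin N → ℝ → EuclideanSpace ℝ (Fin 2))
        (Ybar : Fin N → EuclideanSpace ℝ (Fin 2)),
        -- regularity: each component is measurable with compact support
        (∀ i, ∀ t : ℝ, 0 ≤ t → Measurable (ωi i t)) →
        (∀ i, ∀ t : ℝ, 0 ≤ t → HasCompactSupport (ωi i t)) →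
        -- definite sign: aᵢ·ωᵢ ≥ 0
        (∀ i, ∀ t : ℝ, 0 ≤ t → ∀ x, 0 ≤ a i * ωi i t x) →
        -- conserved intensity: ∫ ωᵢ = aᵢ
        (∀ i, ∀ t : ℝ, 0 ≤ t → (∫ x, ωi i t x) = a i) →
        -- conserved Lᵖ norm, finite
        (∀ i, ∀ t : ℝ, 0 ≤ t →
          eLpNorm (ωi i t) (ENNReal.ofReal p) volume = eLpNorm (ωi i 0) (ENNReal.ofReal p) volume) →
        (∀ i, eLpNorm (ωi i 0) (ENNReal.ofReal p) volume < ⊤) →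
        -- scaling assumption ‖ω(0)‖_{Lᵖ} ≤ Λ ε^{−γ}
        eLpNorm (fun x => ∑ i, ωi i 0 x) (ENNReal.ofReal p) volume ≤ ENNReal.ofReal (Λ * ε ^ (-γ)) →
        -- Biot–Savart velocity
        (∀ t x, u t x = ∫ y, (∑ j, ωi j t y) • biotSavart (x - y)) →
        -- weak formulation of the transport equations ∂ₜωᵢ + u·∇ωᵢ = 0
        (∀ i, ∀ φ : EuclideanSpace ℝ (Fin 2) → ℝ, ContDiff ℝ 1 φ →
          (∃ M, ∀ x, ‖gradient φ x‖ ≤ M) →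
          ∀ t : ℝ, 0 ≤ t → HasDerivWithinAt (fun s => ∫ x, ωi i s x * φ x)
            (∫ x, ωi i t x * ⟪u t x, gradient φ x⟫) (Set.Ici 0) t) →
        -- vorticity centers
        (∀ i t, X i t = (a i)⁻¹ • ∫ x, ωi i t x • x) →
        -- initial support in B_R(Xᵢ(0))
        (∀ i, Function.support (ωi i 0) ⊆ Metric.ball (X i 0) R) →
        -- initial separation of the supports by δ
        (∀ i j, i ≠ j → ∀ x ∈ Function.support (ωi i 0), ∀ y ∈ Function.support (ωi j 0),
          δ ≤ dist x y) →
        -- initial concentration around the points Ȳᵢ at scale ε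
        (∀ i, (a i)⁻¹ * ∫ x, ‖x - Ybar i‖ ^ 2 * ωi i 0 x ≤ ε ^ 2) →
        ∀ i : Fin N, ∀ ρ h : ℝ, R ≤ ρ → ρ ≤ 2 * R → 0 < h → h < 1 → h < ρ →
        ∀ ψρ ψρh : EuclideanSpace ℝ (Fin 2) → ℝ,
          IsCutoff C₁ ρ h ψρ → IsCutoff C₁ (ρ - h) h ψρh →
        ∀ T : ℝ, 0 < T → T ≤ T₀ →
          (∀ s ∈ Set.Icc (0:ℝ) T, ∀ k j : Fin N, k ≠ j →
            ∀ x ∈ Function.support (ωi k s), ∀ y ∈ Function.support (ωi j s), δ / 2 ≤ dist x y) →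
        ∀ t ∈ Set.Icc (0:ℝ) T,
          (a i)⁻¹ * (∫ x, (1 - ψρ (x - X i t)) * ωi i t x)
            ≤ (a i)⁻¹ * (∫ x, (1 - ψρ (x - X i 0)) * ωi i 0 x)
              + C * (ε ^ 2 / h ^ 2 + 1 / h) *
                ∫ s in (0:ℝ)..t, (a i)⁻¹ * ∫ x, (1 - ψρh (x - X i s)) * ωi i s x := by
  have hpi := Real.pi_pos
  have hS : 0 < ∑ j, |a j| :=
    Finset.sum_pos (fun j _ => abs_pos.2 (ha j)) ⟨⟨0, hN⟩, Finset.mem_univ _⟩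
  have hd : 0 < δ / 2 := by positivity
  refine ⟨(∑ j, |a j|) * C₁ *
    (2 * Real.exp (4 * ((∑ j, |a j|) * (2 * Real.pi * (δ / 2) ^ 2)⁻¹) * T₀) /
      (Real.pi * R ^ 2) + 1 / (Real.pi * R) + 1 / (Real.pi * (δ / 2))), by positivity, ?_⟩
  intro p γ Λ hp _ _ ε _ ω u X Y hmeas hsupp hpos hint hcons hfin _ hu hweak hX _ _ hY i ρ h hRρ _
    hh _ _ ψ ψ' hψ hψ' T _ hTT₀ hsep t ht
  obtain ⟨M, H⟩ := exists_isVortexFlow ha hp hmeas hsupp hpos hint hcons hfin hu hweak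
  have hcenter : ∀ s, 0 ≤ s → ∫ x, x ∂normalizedMeasure (a i) (ω i s) = X i s := fun s hs => by
    rw [integral_normalizedMeasure (hmeas i s hs) (hpos i s hs), hX]
  have hmass : ∀ (χ : Plane → ℝ) s, 0 ≤ s →
      ∫ x, (1 - χ (x - ∫ y, y ∂normalizedMeasure (a i) (ω i s))) ∂normalizedMeasure (a i) (ω i s) =
        (a i)⁻¹ * ∫ x, (1 - χ (x - X i s)) * ω i s x := fun χ s hs => by
    rw [hcenter s hs, integral_normalizedMeasure (hmeas i s hs) (hpos i s hs)]
    simp only [smul_eq_mul, mul_comm]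
  have hmoment : ∫ x, ‖x - ∫ y, y ∂normalizedMeasure (a i) (ω i 0)‖ ^ 2
      ∂normalizedMeasure (a i) (ω i 0) ≤ ε ^ 2 := by
    refine (H.moment_le_of_point i le_rfl (Y i)).trans ?_
    rw [integral_normalizedMeasure (hmeas i 0 le_rfl) (hpos i 0 le_rfl)]
    simpa only [smul_eq_mul, mul_comm] using hY i
  have hsep' : ∀ s ∈ Set.Icc 0 T,
      IsSeparated (fun i t => normalizedMeasure (a i) (ω i t)) i s (δ / 2) := fun s hs => by
    filter_upwards [ae_normalizedMeasure_mem_support (hmeas i s hs.1)] with x hx j hj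
    filter_upwards [ae_normalizedMeasure_mem_support (hmeas j s hs.1)] with y hy
    rw [← dist_eq_norm]
    exact hsep s hs i j hj.symm x hx y hy
  have key := H.outer_mass_le hTT₀ hd hsep' hmoment hR hRρ hC₁.le hh hψ hψ' ht
  rw [hmass ψ t ht.1, hmass ψ 0 le_rfl, intervalIntegral.integral_congr
    (g := fun s => (a i)⁻¹ * ∫ x, (1 - ψ' (x - X i s)) * ω i s x)] at key
  · exact key
  · intro s hs
    rw [Set.uIcc_of_le ht.1] at hs
    exact hmass ψ' s hs.1
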